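/- Let g : ℕ → ℝ be essentially bounded, fix ϑ ∈ (1/3,1) and G ∈ (0,1), and set θ₀ = (3ϑ−1)/((1−G)ϑ+G+1). Assume that for every θ ∈ (θ₀, ϑ] and all constants 0 < c₁ < c₂ there exists C > 0 such that J_{sgn,g}(M,h) ≤ C·M·h^{2−G} for all positive integers M, h with c₁·M^θ ≤ h ≤ c₂·M^θ. Then for every G′ ∈ (0, min((3−ϑ^{−1})/(1+2G^{−1}), ϑ^{−1}−1)) and all constants 0 < c₁ < c₂ there exists C′ > 0 such that J_{sgn,g∗1}(N,H) ≤ C′·N·H^{2−G′} for all positive integers N, H with c₁·N^ϑ ≤ H ≤ c₂·N^ϑ. -/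

import Mathlib

/-- sgn(0)=0, sgn(t)=t/|t| for t≠0. -/
noncomputable def sgn (t : ℤ) : ℝ := if 0 < t then 1 else if t < 0 then -1 else 0

/-- The symmetry integral `J_{sgn,f}(N,H)`. -/
noncomputable def Jsgn (f : ℕ → ℝ) (N H : ℕ) : ℝ :=
  ∑ x ∈ Finset.Ioc N (2 * N),
    (∑ n ∈ Finset.Icc (x - H) (x + H), f n * sgn ((n : ℤ) - (x : ℤ))) ^ 2

/-- `g` is essentially bounded: for every `ε > 0`, `g(n) ≪_ε n^ε`. -/
def EssBdd (g : ℕ → ℝ) : Prop :=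
  ∀ ε : ℝ, 0 < ε → ∃ C : ℝ, 0 < C ∧ ∀ n : ℕ, 0 < n → |g n| ≤ C * (n : ℝ) ^ ε

/-- The additive character `t ↦ exp(2πit)`. -/
noncomputable def ex (t : ℝ) : ℂ := Complex.exp ((2 * Real.pi * t : ℝ) * Complex.I)

lemma norm_ex (t : ℝ) : ‖ex t‖ = 1 := Complex.norm_exp_ofReal_mul_I _

lemma ex_zero : ex 0 = 1 := by simp [ex]

lemma ex_add (s t : ℝ) : ex (s + t) = ex s * ex t := by
  simp only [ex, ← Complex.exp_add]
  congr 1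
  push_cast
  ring

lemma conj_ex (t : ℝ) : (starRingEnd ℂ) (ex t) = ex (-t) := by
  simp only [ex, ← Complex.exp_conj, map_mul, Complex.conj_ofReal, Complex.conj_I]
  congr 1
  push_cast
  ring

lemma ex_natCast_mul (n : ℕ) (t : ℝ) : ex (n * t) = ex t ^ n := by
  simp only [ex, ← Complex.exp_nat_mul]
  congr 1
  push_cast
  ring

lemma ex_natCast (n : ℕ) : ex n = 1 := by
  simp only [ex]
  rw [Complex.exp_eq_one_iff]
  exact ⟨n, by push_cast; ring⟩

lemma norm_ex_sub_one (t : ℝ) : ‖ex t - 1‖ = 2 * |Real.sin (Real.pi * t)| := by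
  have h := Complex.norm_exp_I_mul_ofReal_sub_one (2 * Real.pi * t)
  rw [mul_comm Complex.I] at h
  rw [ex, h, norm_mul, Real.norm_eq_abs, Real.norm_eq_abs, abs_two]
  congr 3
  ring

lemma mul_one_sub_le_sin_pi_mul {t : ℝ} (h0 : 0 ≤ t) (h1 : t ≤ 1) :
    t * (1 - t) ≤ Real.sin (Real.pi * t) := by
  have key : ∀ s : ℝ, 0 ≤ s → s ≤ 1 / 2 → 2 * s ≤ Real.sin (Real.pi * s) := by
    intro s hs hs'
    have hp := Real.pi_pos
    have := Real.mul_le_sin (x := Real.pi * s) (by positivity) (by nlinarith)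
    rwa [← mul_assoc, div_mul_cancel₀ _ hp.ne'] at this
  rcases le_total t (1 / 2) with h | h
  · nlinarith [key t h0 h]
  · have := key (1 - t) (by linarith) (by linarith)
    rw [show Real.pi * (1 - t) = Real.pi - Real.pi * t by ring, Real.sin_pi_sub] at this
    nlinarith

lemma norm_sum_Ioc_ex_le (a b : ℕ) {t : ℝ} (h0 : 0 < t) (h1 : t < 1) :
    ‖∑ x ∈ Finset.Ioc a b, ex (x * t)‖ ≤ 1 / t + 1 / (1 - t) := by
  have ht : 0 < t * (1 - t) := mul_pos h0 (by linarith)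
  have hs := mul_one_sub_le_sin_pi_mul h0.le h1.le
  have e : 1 / t + 1 / (1 - t) = 1 / (t * (1 - t)) := by
    have : 1 - t ≠ 0 := by linarith
    field_simp
    ring
  rw [e]
  rcases le_total b a with hab | hab
  · rw [Finset.Ioc_eq_empty_of_le hab, Finset.sum_empty, norm_zero]
    positivity
  · have h : (∑ x ∈ Finset.Ioc a b, ex (x * t)) * (ex t - 1) = ex t ^ (b + 1) - ex t ^ (a + 1) := by
      have : Finset.Ioc a b = Finset.Ico (a + 1) (b + 1) := by
        ext
        simp only [Finset.mem_Ioc, Finset.mem_Ico]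
        omega
      rw [this, ← geom_sum_Ico_mul _ (by omega)]
      simp only [ex_natCast_mul]
    have h2 : ‖∑ x ∈ Finset.Ioc a b, ex (x * t)‖ * ‖ex t - 1‖ ≤ 2 := by
      rw [← norm_mul, h]
      refine (norm_sub_le _ _).trans ?_
      simp only [norm_pow, norm_ex, one_pow]
      norm_num
    rw [norm_ex_sub_one, abs_of_nonneg (ht.le.trans hs)] at h2
    rw [le_div_iff₀ ht]
    nlinarith [norm_nonneg (∑ x ∈ Finset.Ioc a b, ex (x * t))]

lemma norm_sum_Ioc_ex_neg (a b : ℕ) (t : ℝ) :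
    ‖∑ x ∈ Finset.Ioc a b, ex (x * (-t))‖ = ‖∑ x ∈ Finset.Ioc a b, ex (x * t)‖ := by
  rw [← RCLike.norm_conj, map_sum]
  simp only [conj_ex, mul_neg, neg_neg]

/-- The large sieve inequality in its weak form, via Schur's test. -/
lemma sum_norm_sq_exp_sum_le {ι : Type*} (R : Finset ι) (α : ι → ℝ) (c : ι → ℂ) (a b : ℕ) (W : ℝ)
    (hW : ∀ r ∈ R, ∑ s ∈ R, ‖∑ x ∈ Finset.Ioc a b, ex (x * (α r - α s))‖ ≤ W) :
    ∑ x ∈ Finset.Ioc a b, ‖∑ r ∈ R, c r * ex (x * α r)‖ ^ 2 ≤ W * ∑ r ∈ R, ‖c r‖ ^ 2 := by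
  set K : ι → ι → ℂ := fun r s => ∑ x ∈ Finset.Ioc a b, ex (x * (α r - α s)) with hK
  have hsymm : ∀ r s, ‖K r s‖ = ‖K s r‖ := by
    intro r s
    simp only [hK]
    rw [← norm_sum_Ioc_ex_neg a b (α s - α r), neg_sub]
  have expand : ((∑ x ∈ Finset.Ioc a b, ‖∑ r ∈ R, c r * ex (x * α r)‖ ^ 2 : ℝ) : ℂ)
      = ∑ r ∈ R, ∑ s ∈ R, c r * (starRingEnd ℂ) (c s) * K r s := by
    push_cast
    simp only [← Complex.mul_conj', map_sum, map_mul, conj_ex, Finset.sum_mul_sum, hK]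
    rw [Finset.sum_comm]
    refine Finset.sum_congr rfl fun r _ => ?_
    rw [Finset.sum_comm]
    refine Finset.sum_congr rfl fun s _ => ?_
    rw [Finset.mul_sum]
    refine Finset.sum_congr rfl fun x _ => ?_
    have : (x : ℝ) * (α r - α s) = x * α r + -(x * α s) := by ring
    rw [this, ex_add]
    ring
  have hnn : 0 ≤ ∑ x ∈ Finset.Ioc a b, ‖∑ r ∈ R, c r * ex (x * α r)‖ ^ 2 :=
    Finset.sum_nonneg fun _ _ => by positivity
  calc ∑ x ∈ Finset.Ioc a b, ‖∑ r ∈ R, c r * ex (x * α r)‖ ^ 2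
      = ‖∑ r ∈ R, ∑ s ∈ R, c r * (starRingEnd ℂ) (c s) * K r s‖ := by
        rw [← expand, Complex.norm_real, Real.norm_of_nonneg hnn]
    _ ≤ ∑ r ∈ R, ∑ s ∈ R, (‖c r‖ ^ 2 / 2 * ‖K r s‖ + ‖c s‖ ^ 2 / 2 * ‖K s r‖) := by
        refine norm_sum_le_of_le _ fun r _ => norm_sum_le_of_le _ fun s _ => ?_
        rw [norm_mul, norm_mul, RCLike.norm_conj, hsymm s r]
        nlinarith [norm_nonneg (K r s), sq_nonneg (‖c r‖ - ‖c s‖)]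
    _ = ∑ r ∈ R, ‖c r‖ ^ 2 * ∑ s ∈ R, ‖K r s‖ := by
        simp only [Finset.sum_add_distrib]
        rw [Finset.sum_comm (f := fun r s => ‖c s‖ ^ 2 / 2 * ‖K s r‖), ← Finset.sum_add_distrib]
        refine Finset.sum_congr rfl fun r _ => ?_
        rw [← Finset.mul_sum]
        ring
    _ ≤ ∑ r ∈ R, ‖c r‖ ^ 2 * W :=
        Finset.sum_le_sum fun r hr => mul_le_mul_of_nonneg_left (hW r hr) (by positivity)
    _ = W * ∑ r ∈ R, ‖c r‖ ^ 2 := by rw [← Finset.sum_mul, mul_comm]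

/-- The harmonic sum `∑_{i ≤ n} 1/i`. -/
noncomputable def harm (n : ℕ) : ℝ := ∑ i ∈ Finset.Icc 1 n, 1 / (i : ℝ)

lemma harm_nonneg (n : ℕ) : 0 ≤ harm n := Finset.sum_nonneg fun _ _ => by positivity

lemma harm_mono {m n : ℕ} (h : m ≤ n) : harm m ≤ harm n :=
  Finset.sum_le_sum_of_subset_of_nonneg (Finset.Icc_subset_Icc_right h) fun _ _ _ => by positivity

lemma harm_le_one_add_log (n : ℕ) : harm n ≤ 1 + Real.log n := by
  have := harmonic_le_one_add_log n
  rw [harmonic_eq_sum_Icc] at this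
  simpa [harm] using this

lemma exists_harm_le_rpow {ε : ℝ} (hε : 0 < ε) :
    ∃ C : ℝ, 0 < C ∧ ∀ n : ℕ, 0 < n → harm n ≤ C * (n : ℝ) ^ ε := by
  refine ⟨1 + 1 / ε, by positivity, fun n hn => ?_⟩
  have h1 : (1 : ℝ) ≤ n := by exact_mod_cast hn
  have h2 : 1 ≤ (n : ℝ) ^ ε := Real.one_le_rpow h1 hε.le
  have h3 := Real.log_le_rpow_div (x := n) (by positivity) hε
  calc harm n ≤ 1 + Real.log n := harm_le_one_add_log n
    _ ≤ (n : ℝ) ^ ε + (n : ℝ) ^ ε / ε := by linarith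
    _ = _ := by ring

/-- Reciprocals of separated points of `(0,1)` have a sum of logarithmic growth. -/
lemma sum_one_div_le_of_separated {ι : Type*} (R : Finset ι) (t : ι → ℝ) (L : ℕ) (hL : 0 < L)
    (h0 : ∀ s ∈ R, 1 / (L : ℝ) ≤ t s) (h1 : ∀ s ∈ R, t s < 1)
    (hsep : ∀ s ∈ R, ∀ s' ∈ R, s ≠ s' → 1 / (L : ℝ) ≤ |t s - t s'|) :
    ∑ s ∈ R, 1 / t s ≤ L * harm L := by
  have hLr : (0 : ℝ) < L := by exact_mod_cast hL
  have hpos : ∀ s ∈ R, 1 ≤ (L : ℝ) * t s := fun s hs => by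
    have := h0 s hs
    rw [div_le_iff₀ hLr] at this
    linarith
  have hinj : Set.InjOn (fun s => ⌊(L : ℝ) * t s⌋₊) R := by
    intro s hs s' hs' h
    by_contra hne
    have h2 := hsep s hs s' hs' hne
    rw [div_le_iff₀ hLr] at h2
    have a1 := Nat.floor_le (a := (L : ℝ) * t s) (by linarith [hpos s hs])
    have a2 := Nat.lt_floor_add_one ((L : ℝ) * t s)
    have a3 := Nat.floor_le (a := (L : ℝ) * t s') (by linarith [hpos s' hs'])
    have a4 := Nat.lt_floor_add_one ((L : ℝ) * t s')
    simp only at h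
    rw [h] at a1 a2
    have : |t s - t s'| * L < 1 := by
      have e : |t s - t s'| * L = |(t s - t s') * L| := by rw [abs_mul, abs_of_pos hLr]
      rw [e, abs_lt]
      constructor <;> nlinarith
    linarith
  calc ∑ s ∈ R, 1 / t s ≤ ∑ s ∈ R, (L : ℝ) * (1 / ((⌊(L : ℝ) * t s⌋₊ : ℕ) : ℝ)) := by
        refine Finset.sum_le_sum fun s hs => ?_
        have a1 := Nat.floor_le (a := (L : ℝ) * t s) (by linarith [hpos s hs])
        have a5 : 1 ≤ ⌊(L : ℝ) * t s⌋₊ := Nat.le_floor (by simpa using hpos s hs)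
        have a6 : (0 : ℝ) < (⌊(L : ℝ) * t s⌋₊ : ℕ) := by exact_mod_cast a5
        have a7 : 0 < t s := lt_of_lt_of_le (by positivity) (h0 s hs)
        rw [mul_one_div, div_le_div_iff₀ a7 a6]
        linarith
    _ = ∑ i ∈ R.image (fun s => ⌊(L : ℝ) * t s⌋₊), (L : ℝ) * (1 / (i : ℝ)) := by
        rw [Finset.sum_image hinj]
    _ ≤ ∑ i ∈ Finset.Icc 1 L, (L : ℝ) * (1 / (i : ℝ)) := by
        refine Finset.sum_le_sum_of_subset_of_nonneg ?_ fun _ _ _ => by positivity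
        intro i hi
        obtain ⟨s, hs, rfl⟩ := Finset.mem_image.1 hi
        refine Finset.mem_Icc.2 ⟨Nat.le_floor (by simpa using hpos s hs), ?_⟩
        refine Nat.floor_le_of_le ?_
        nlinarith [h1 s hs]
    _ = L * harm L := by rw [harm, Finset.mul_sum]

lemma one_div_sq_le_abs_of_ne_zero {D : ℕ} (a b : ℚ) (ha : a.den ≤ D) (hb : b.den ≤ D) (n : ℤ)
    (h : a - b + n ≠ 0) : 1 / ((D ^ 2 : ℕ) : ℝ) ≤ |(a : ℝ) - b + n| := by
  have hda : (0 : ℝ) < a.den := by exact_mod_cast a.den_pos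
  have hdb : (0 : ℝ) < b.den := by exact_mod_cast b.den_pos
  have e : (a : ℝ) - b + n = (a.num * b.den - b.num * a.den + n * (a.den * b.den) : ℤ) / (a.den * b.den) := by
    rw [Rat.cast_def a, Rat.cast_def b]
    push_cast
    field_simp
  have hne : (a.num * b.den - b.num * a.den + n * (a.den * b.den) : ℤ) ≠ 0 := by
    intro h0
    rw [h0] at e
    apply h
    have : ((a - b + n : ℚ) : ℝ) = 0 := by push_cast; rw [e]; simp
    exact_mod_cast this
  rw [e, abs_div, abs_of_pos (mul_pos hda hdb)]
  have h1 : (1 : ℝ) ≤ |((a.num * b.den - b.num * a.den + n * (a.den * b.den) : ℤ) : ℝ)| := by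
    exact_mod_cast Int.one_le_abs hne
  have h2 : (a.den : ℝ) * b.den ≤ ((D ^ 2 : ℕ) : ℝ) := by
    push_cast
    rw [sq]
    exact mul_le_mul (by exact_mod_cast ha) (by exact_mod_cast hb) hdb.le (by positivity)
  exact div_le_div₀ (by positivity) h1 (mul_pos hda hdb) h2

/-- The rationals of `[0,1)` with denominator at most `D`. -/
def farey (D : ℕ) : Finset ℚ :=
  ((Finset.Icc 1 D).sigma fun d => Finset.range d).image fun p => (p.2 : ℚ) / p.1

lemma den_natCast_div_dvd (j d : ℕ) : ((j : ℚ) / d).den ∣ d := by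
  have := Rat.den_dvd (j : ℤ) (d : ℤ)
  rw [Rat.divInt_eq_div, Int.cast_natCast, Int.cast_natCast] at this
  exact Int.natCast_dvd_natCast.1 this

lemma mem_farey {D : ℕ} {r : ℚ} (hr : r ∈ farey D) : 0 ≤ r ∧ r < 1 ∧ r.den ≤ D := by
  obtain ⟨⟨d, j⟩, hp, rfl⟩ := Finset.mem_image.1 hr
  simp only [Finset.mem_sigma, Finset.mem_Icc, Finset.mem_range] at hp
  have hd : (0 : ℚ) < d := by exact_mod_cast hp.1.1
  refine ⟨by positivity, ?_, ?_⟩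
  · rw [div_lt_one hd]
    exact_mod_cast hp.2
  · exact (Nat.le_of_dvd hp.1.1 (den_natCast_div_dvd j d)).trans hp.1.2

lemma sum_farey_norm_le (D a b : ℕ) (hD : 0 < D) {r : ℚ} (hr : r ∈ farey D) :
    ∑ s ∈ farey D, ‖∑ x ∈ Finset.Ioc a b, ex (x * ((r : ℝ) - (s : ℝ)))‖
      ≤ ((b - a : ℕ) : ℝ) + 2 * ((D ^ 2 : ℕ) : ℝ) * harm (D ^ 2) := by
  classical
  have hL : 0 < D ^ 2 := by positivity
  have hLr : (0 : ℝ) < ((D ^ 2 : ℕ) : ℝ) := by exact_mod_cast hL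
  obtain ⟨hr0, hr1, hrd⟩ := mem_farey hr
  set n : ℚ → ℤ := fun s => if s < r then 0 else 1 with hn
  set t : ℚ → ℝ := fun s => (r : ℝ) - s + n s with ht
  have hb : ∀ s ∈ (farey D).erase r, 0 < t s ∧ t s < 1 := by
    intro s hs
    obtain ⟨hs0, hs1, -⟩ := mem_farey (Finset.mem_of_mem_erase hs)
    have hne := Finset.ne_of_mem_erase hs
    have r0 : (0 : ℝ) ≤ r := by exact_mod_cast hr0
    have r1 : (r : ℝ) < 1 := by exact_mod_cast hr1
    have s0 : (0 : ℝ) ≤ s := by exact_mod_cast hs0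
    have s1 : (s : ℝ) < 1 := by exact_mod_cast hs1
    simp only [ht, hn]
    split_ifs with h
    · have : (s : ℝ) < r := by exact_mod_cast h
      push_cast
      constructor <;> linarith
    · have : (r : ℝ) < s := by exact_mod_cast lt_of_le_of_ne (not_lt.1 h) hne.symm
      push_cast
      constructor <;> linarith
  have hcast : ∀ (a b : ℚ) (m : ℤ), (a : ℝ) - b + m ≠ 0 → a - b + m ≠ 0 := by
    intro a b m h h'
    apply h
    exact_mod_cast h'
  have hlow : ∀ s ∈ (farey D).erase r, 1 / ((D ^ 2 : ℕ) : ℝ) ≤ t s := by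
    intro s hs
    obtain ⟨h0, -⟩ := hb s hs
    have h := one_div_sq_le_abs_of_ne_zero r s hrd (mem_farey (Finset.mem_of_mem_erase hs)).2.2 (n s)
      (hcast _ _ _ h0.ne')
    change _ ≤ |t s| at h
    rwa [abs_of_pos h0] at h
  have hlow' : ∀ s ∈ (farey D).erase r, 1 / ((D ^ 2 : ℕ) : ℝ) ≤ 1 - t s := by
    intro s hs
    obtain ⟨-, h1⟩ := hb s hs
    have e : (s : ℝ) - r + (1 - n s : ℤ) = 1 - t s := by
      simp only [ht]
      push_cast
      ring
    have h := one_div_sq_le_abs_of_ne_zero s r (mem_farey (Finset.mem_of_mem_erase hs)).2.2 hrd (1 - n s)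
      (hcast _ _ _ (by rw [e]; linarith))
    rwa [e, abs_of_pos (by linarith)] at h
  have hsep : ∀ s ∈ (farey D).erase r, ∀ s' ∈ (farey D).erase r, s ≠ s' →
      1 / ((D ^ 2 : ℕ) : ℝ) ≤ |t s - t s'| := by
    intro s hs s' hs' hne
    have m := mem_farey (Finset.mem_of_mem_erase hs)
    have m' := mem_farey (Finset.mem_of_mem_erase hs')
    have e : (s' : ℝ) - s + (n s - n s' : ℤ) = t s - t s' := by
      simp only [ht]
      push_cast
      ring
    rw [← e]
    refine one_div_sq_le_abs_of_ne_zero s' s m'.2.2 m.2.2 _ ?_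
    simp only [hn]
    intro h
    have : s ≠ s' := hne
    split_ifs at h <;> push_cast at h
    · exact hne (by linarith)
    · linarith
    · linarith
    · exact hne (by linarith)
  rw [← Finset.add_sum_erase _ _ hr]
  have hdiag : ‖∑ x ∈ Finset.Ioc a b, ex (x * ((r : ℝ) - (r : ℝ)))‖ ≤ ((b - a : ℕ) : ℝ) := by
    simp [ex_zero]
  have hoff : ∀ s ∈ (farey D).erase r,
      ‖∑ x ∈ Finset.Ioc a b, ex (x * ((r : ℝ) - (s : ℝ)))‖ ≤ 1 / t s + 1 / (1 - t s) := by
    intro s hs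
    have e : ∀ x : ℕ, ex (x * ((r : ℝ) - (s : ℝ))) = ex (x * t s) := by
      intro x
      simp only [ht, hn]
      split_ifs
      · simp
      · rw [Int.cast_one, mul_add, ex_add _ ((x : ℝ) * 1), mul_one, ex_natCast, mul_one]
    simp only [e]
    exact norm_sum_Ioc_ex_le a b (hb s hs).1 (hb s hs).2
  have h1 := sum_one_div_le_of_separated ((farey D).erase r) t (D ^ 2) hL hlow (fun s hs => (hb s hs).2) hsep
  have h2 := sum_one_div_le_of_separated ((farey D).erase r) (fun s => 1 - t s) (D ^ 2) hL hlow'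
    (fun s hs => by linarith [(hb s hs).1])
    (fun s hs s' hs' hne => by
      have := hsep s' hs' s hs hne.symm
      rwa [show (1 - t s) - (1 - t s') = t s' - t s by ring])
  have h3 := Finset.sum_le_sum hoff
  rw [Finset.sum_add_distrib] at h3
  linarith

lemma sum_Icc_sub_add {M : Type*} [AddCommMonoid M] (φ : ℕ → M) (x H : ℕ) (h : H ≤ x) :
    ∑ n ∈ Finset.Icc (x - H) (x + H), φ n
      = φ x + ∑ k ∈ Finset.Icc 1 H, (φ (x + k) + φ (x - k)) := by
  induction H with
  | zero => simp
  | succ H ih =>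
    have e : Finset.Icc (x - (H + 1)) (x + (H + 1))
        = insert (x - (H + 1)) (insert (x + (H + 1)) (Finset.Icc (x - H) (x + H))) := by
      ext n
      simp only [Finset.mem_insert, Finset.mem_Icc]
      omega
    rw [e, Finset.sum_insert, Finset.sum_insert, ih (by omega), Finset.sum_Icc_succ_top (by omega)]
    · abel
    · simp only [Finset.mem_Icc]
      omega
    · simp only [Finset.mem_insert, Finset.mem_Icc]
      omega

/-- The Fourier transform of the sign function on `[-H, H]`. -/
noncomputable def sgnFourier (H : ℕ) (α : ℝ) : ℂ :=
  ∑ k ∈ Finset.Icc 1 H, (ex (k * α) - ex (-(k * α)))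

lemma sum_sgn_mul_ex (x H : ℕ) (h : H ≤ x) (α : ℝ) :
    ∑ n ∈ Finset.Icc (x - H) (x + H), (sgn ((n : ℤ) - x) : ℂ) * ex (n * α)
      = sgnFourier H α * ex (x * α) := by
  rw [sum_Icc_sub_add _ _ _ h, sgnFourier, Finset.sum_mul]
  simp only [sub_self]
  have z : sgn 0 = 0 := by simp [sgn]
  rw [z, Complex.ofReal_zero, zero_mul, zero_add]
  refine Finset.sum_congr rfl fun k hk => ?_
  rw [Finset.mem_Icc] at hk
  have e1 : sgn (((x + k : ℕ) : ℤ) - x) = 1 := by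
    rw [sgn, if_pos]
    omega
  have e2 : sgn (((x - k : ℕ) : ℤ) - x) = -1 := by
    rw [sgn, if_neg, if_pos] <;> omega
  rw [e1, e2, Nat.cast_sub (by omega)]
  push_cast
  rw [add_mul, sub_mul, sub_eq_add_neg, ex_add, ex_add]
  ring

lemma sgnFourier_zero (H : ℕ) : sgnFourier H 0 = 0 := by simp [sgnFourier]

lemma norm_sgnFourier_sq_le (H : ℕ) {t : ℝ} (h0 : 0 < t) (h1 : t < 1) :
    ‖sgnFourier H t‖ ^ 2 ≤ 4 * H * (1 / t + 1 / (1 - t)) := by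
  have a : ‖sgnFourier H t‖ ≤ 2 * H := by
    refine (norm_sum_le_of_le (n := fun _ => (2 : ℝ)) _ fun k _ => ?_).trans ?_
    · refine (norm_sub_le _ _).trans ?_
      rw [norm_ex, norm_ex]
      norm_num
    · simp [mul_comm]
  have b : ‖sgnFourier H t‖ ≤ 2 * (1 / t + 1 / (1 - t)) := by
    have e : Finset.Icc 1 H = Finset.Ioc 0 H := by
      ext
      simp only [Finset.mem_Icc, Finset.mem_Ioc]
      omega
    rw [sgnFourier, Finset.sum_sub_distrib, e]
    have h2 := norm_sum_Ioc_ex_le 0 H h0 h1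
    have h3 := h2
    rw [← norm_sum_Ioc_ex_neg] at h3
    simp only [mul_neg] at h3
    exact (norm_sub_le _ _).trans (by linarith)
  have := mul_le_mul a b (norm_nonneg _) (by positivity)
  nlinarith

lemma sum_range_ex_div (d n : ℕ) (hd : 0 < d) :
    ∑ j ∈ Finset.range d, ex (n * ((j : ℝ) / d)) = if d ∣ n then (d : ℂ) else 0 := by
  have hζ := Complex.isPrimitiveRoot_exp d hd.ne'
  have e : ∀ j : ℕ, ex (n * ((j : ℝ) / d)) = (Complex.exp (2 * Real.pi * Complex.I / d) ^ n) ^ j := by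
    intro j
    rw [ex, ← Complex.exp_nat_mul, ← Complex.exp_nat_mul]
    congr 1
    push_cast
    ring
  simp only [e]
  split_ifs with h
  · rw [(hζ.pow_eq_one_iff_dvd n).2 h]
    simp
  · have h1 : Complex.exp (2 * Real.pi * Complex.I / d) ^ n ≠ 1 := fun h' =>
      h ((hζ.pow_eq_one_iff_dvd n).1 h')
    rw [geom_sum_eq h1, ← pow_mul, mul_comm n d, pow_mul, hζ.pow_eq_one]
    simp

/-- Number of multiples of `d` in `(x, x+H]` minus that in `[x-H, x)`. -/
noncomputable def sgnCount (H d x : ℕ) : ℝ :=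
  ∑ n ∈ Finset.Icc (x - H) (x + H), if d ∣ n then sgn ((n : ℤ) - x) else 0

lemma sgnCount_eq (H d x : ℕ) (hd : 0 < d) (h : H ≤ x) :
    (sgnCount H d x : ℂ)
      = ∑ j ∈ Finset.range d, (1 / d : ℂ) * sgnFourier H ((j : ℝ) / d) * ex (x * ((j : ℝ) / d)) := by
  have hd' : (d : ℂ) ≠ 0 := by exact_mod_cast hd.ne'
  simp only [mul_assoc, ← sum_sgn_mul_ex x H h]
  rw [← Finset.mul_sum, Finset.sum_comm]
  simp only [← Finset.mul_sum, sum_range_ex_div _ _ hd]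
  rw [sgnCount]
  push_cast
  rw [Finset.mul_sum]
  refine Finset.sum_congr rfl fun n _ => ?_
  split_ifs
  · field_simp
  · simp

lemma sum_fiber_farey_le (D : ℕ) (r : ℚ) :
    ∑ p ∈ ((Finset.Icc 1 D).sigma fun d => Finset.range d) with (p.2 : ℚ) / p.1 = r, 1 / (p.1 : ℝ)
      ≤ harm D / r.den := by
  have key : ∀ p ∈ ((Finset.Icc 1 D).sigma fun d => Finset.range d).filter
      (fun p => (p.2 : ℚ) / p.1 = r), 0 < p.1 ∧ p.1 ≤ D ∧ r.den ∣ p.1 ∧ (p.2 : ℚ) = r * p.1 := by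
    intro p hp
    simp only [Finset.mem_filter, Finset.mem_sigma, Finset.mem_Icc, Finset.mem_range] at hp
    obtain ⟨⟨⟨h1, h2⟩, -⟩, h3⟩ := hp
    refine ⟨h1, h2, ?_, ?_⟩
    · rw [← h3]
      exact den_natCast_div_dvd _ _
    · have : (p.1 : ℚ) ≠ 0 := by positivity
      rw [← h3]
      field_simp
  have hq : (0 : ℝ) < r.den := by exact_mod_cast r.den_pos
  set T := ((Finset.Icc 1 D).sigma fun d => Finset.range d).filter (fun p => (p.2 : ℚ) / p.1 = r)
  calc _ = ∑ p ∈ T, (1 / (r.den : ℝ)) * (1 / ((p.1 / r.den : ℕ) : ℝ)) := by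
        refine Finset.sum_congr rfl fun p hp => ?_
        obtain ⟨h1, h2, h3, h4⟩ := key p hp
        rw [Nat.cast_div h3 hq.ne']
        field_simp
    _ = ∑ i ∈ T.image (fun p => p.1 / r.den), (1 / (r.den : ℝ)) * (1 / (i : ℝ)) := by
        rw [Finset.sum_image]
        intro p hp p' hp' h
        obtain ⟨h1, h2, h3, h4⟩ := key p hp
        obtain ⟨h1', h2', h3', h4'⟩ := key p' hp'
        have e1 : p.1 = p'.1 := by
          rw [← Nat.div_mul_cancel h3, ← Nat.div_mul_cancel h3']
          simp only at h
          rw [h]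
        have e2 : p.2 = p'.2 := by
          rw [e1, ← h4'] at h4
          exact_mod_cast h4
        exact Sigma.ext e1 (heq_of_eq e2)
    _ ≤ ∑ i ∈ Finset.Icc 1 D, (1 / (r.den : ℝ)) * (1 / (i : ℝ)) := by
        refine Finset.sum_le_sum_of_subset_of_nonneg ?_ fun _ _ _ => by positivity
        intro i hi
        obtain ⟨p, hp, rfl⟩ := Finset.mem_image.1 hi
        obtain ⟨h1, h2, h3, h4⟩ := key p hp
        refine Finset.mem_Icc.2 ⟨?_, (Nat.div_le_self _ _).trans h2⟩
        exact Nat.div_pos (Nat.le_of_dvd h1 h3) r.den_pos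
    _ = harm D / r.den := by
        rw [← Finset.mul_sum, harm]
        ring

lemma sum_farey_sgnFourier_le (D H : ℕ) :
    ∑ r ∈ farey D, ‖sgnFourier H r‖ ^ 2 / (r.den : ℝ) ^ 2 ≤ 8 * H * harm D ^ 2 := by
  classical
  set φ : (_ : ℕ) × ℕ → ℝ := fun p =>
    4 * H * ((1 / (p.1 : ℝ)) * (1 / (p.2 : ℝ) + 1 / ((p.1 : ℝ) - p.2))) with hφ
  have hinj : Set.InjOn (fun r : ℚ => (⟨r.den, r.num.toNat⟩ : (_ : ℕ) × ℕ)) (farey D) := by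
    intro r hr s hs h
    simp only [Sigma.mk.injEq, heq_eq_eq] at h
    have hr0 := Rat.num_nonneg.2 (mem_farey hr).1
    have hs0 := Rat.num_nonneg.2 (mem_farey hs).1
    exact Rat.ext (by omega) h.1
  have hterm : ∀ r ∈ (farey D).erase 0, ‖sgnFourier H r‖ ^ 2 / (r.den : ℝ) ^ 2
      ≤ φ ⟨r.den, r.num.toNat⟩ := by
    intro r hr
    obtain ⟨hr0, hr1, hrd⟩ := mem_farey (Finset.mem_of_mem_erase hr)
    have hne := Finset.ne_of_mem_erase hr
    have h0 : (0 : ℝ) < r := by exact_mod_cast lt_of_le_of_ne hr0 hne.symm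
    have h1 : (r : ℝ) < 1 := by exact_mod_cast hr1
    have hd : (0 : ℝ) < r.den := by exact_mod_cast r.den_pos
    have hnum : ((r.num.toNat : ℕ) : ℝ) = r * r.den := by
      have e : ((r.num.toNat : ℕ) : ℝ) = (r.num : ℝ) := by
        have := Int.toNat_of_nonneg (Rat.num_nonneg.2 hr0)
        exact_mod_cast this
      rw [e, Rat.cast_def]
      field_simp
    have h := norm_sgnFourier_sq_le H h0 h1
    have h1' : (0 : ℝ) < 1 - r := by linarith
    simp only [hφ]
    rw [hnum, div_le_iff₀ (by positivity)]
    refine h.trans (le_of_eq ?_)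
    have e : (r.den : ℝ) - r * r.den = (1 - r) * r.den := by ring
    rw [e]
    field_simp
  have hrefl : ∀ q : ℕ, ∑ a ∈ Finset.Icc 1 (q - 1), 1 / ((q : ℝ) - a) = harm (q - 1) := by
    intro q
    refine Finset.sum_nbij' (fun a => q - a) (fun a => q - a) ?_ ?_ ?_ ?_ ?_
    · intro a ha
      simp only [Finset.mem_Icc] at ha ⊢
      omega
    · intro a ha
      simp only [Finset.mem_Icc] at ha ⊢
      omega
    · intro a ha
      simp only [Finset.mem_Icc] at ha ⊢
      omega
    · intro a ha
      simp only [Finset.mem_Icc] at ha ⊢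
      omega
    · intro a ha
      simp only [Finset.mem_Icc] at ha
      rw [Nat.cast_sub (by omega)]
  have hφ0 : ∀ p ∈ (Finset.Icc 1 D).sigma fun q => Finset.Icc 1 (q - 1), 0 ≤ φ p := by
    intro p hp
    simp only [Finset.mem_sigma, Finset.mem_Icc] at hp
    have : (0 : ℝ) ≤ (p.1 : ℝ) - p.2 := by
      rw [sub_nonneg]
      exact_mod_cast (by omega : p.2 ≤ p.1)
    simp only [hφ]
    positivity
  calc ∑ r ∈ farey D, ‖sgnFourier H r‖ ^ 2 / (r.den : ℝ) ^ 2
      = ∑ r ∈ (farey D).erase 0, ‖sgnFourier H r‖ ^ 2 / (r.den : ℝ) ^ 2 := by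
        refine (Finset.sum_erase _ ?_).symm
        rw [Rat.cast_zero, sgnFourier_zero]
        simp
    _ ≤ ∑ r ∈ (farey D).erase 0, φ ⟨r.den, r.num.toNat⟩ := Finset.sum_le_sum hterm
    _ = ∑ p ∈ ((farey D).erase 0).image (fun r : ℚ => (⟨r.den, r.num.toNat⟩ : (_ : ℕ) × ℕ)), φ p := by
        rw [Finset.sum_image]
        exact hinj.mono (Finset.coe_subset.2 (Finset.erase_subset _ _))
    _ ≤ ∑ p ∈ (Finset.Icc 1 D).sigma fun q => Finset.Icc 1 (q - 1), φ p := by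
        refine Finset.sum_le_sum_of_subset_of_nonneg ?_ fun p hp _ => hφ0 p hp
        intro p hp
        obtain ⟨r, hr, rfl⟩ := Finset.mem_image.1 hp
        obtain ⟨hr0, hr1, hrd⟩ := mem_farey (Finset.mem_of_mem_erase hr)
        have hne := Finset.ne_of_mem_erase hr
        have hn : 0 < r.num := Rat.num_pos.2 (lt_of_le_of_ne hr0 hne.symm)
        have hn' : r.num < r.den := Rat.num_lt_denom_iff.2 hr1
        have := r.den_pos
        simp only [Finset.mem_sigma, Finset.mem_Icc]
        omega
    _ = ∑ q ∈ Finset.Icc 1 D, 8 * H * ((1 / (q : ℝ)) * harm (q - 1)) := by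
        rw [Finset.sum_sigma]
        refine Finset.sum_congr rfl fun q _ => ?_
        simp only [hφ]
        rw [← Finset.mul_sum, ← Finset.mul_sum, Finset.sum_add_distrib, hrefl]
        rw [← harm]
        ring
    _ ≤ ∑ q ∈ Finset.Icc 1 D, 8 * H * ((1 / (q : ℝ)) * harm D) := by
        refine Finset.sum_le_sum fun q hq => ?_
        rw [Finset.mem_Icc] at hq
        have := harm_mono (m := q - 1) (n := D) (by omega)
        gcongr
    _ = 8 * H * harm D ^ 2 := by
        rw [← Finset.mul_sum, ← Finset.sum_mul, ← harm]
        ring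

/-- Mean square of the sign-count averages over moduli up to `D`. -/
lemma sum_sq_sum_sgnCount_le (g : ℕ → ℝ) (D N H : ℕ) (K : ℝ) (hD : 0 < D) (hH : H ≤ N)
    (hK : ∀ d, 0 < d → d ≤ D → |g d| ≤ K) :
    ∑ x ∈ Finset.Ioc N (2 * N), (∑ d ∈ Finset.Icc 1 D, g d * sgnCount H d x) ^ 2
      ≤ (N + 2 * (D : ℝ) ^ 2 * harm (D ^ 2)) * (8 * H * K ^ 2 * harm D ^ 4) := by
  classical
  have hK0 : 0 ≤ K := (abs_nonneg _).trans (hK 1 one_pos hD)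
  set P := (Finset.Icc 1 D).sigma fun d => Finset.range d with hP
  set c : ℚ → ℂ := fun r => ∑ p ∈ P with (p.2 : ℚ) / p.1 = r, ((g p.1 * (1 / p.1) : ℝ) : ℂ) * sgnFourier H r
    with hc
  have hexp : ∀ x ∈ Finset.Ioc N (2 * N), ((∑ d ∈ Finset.Icc 1 D, g d * sgnCount H d x : ℝ) : ℂ)
      = ∑ r ∈ farey D, c r * ex (x * (r : ℝ)) := by
    intro x hx
    rw [Finset.mem_Ioc] at hx
    push_cast
    calc _ = ∑ d ∈ Finset.Icc 1 D, ∑ j ∈ Finset.range d,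
          ((g d * (1 / d) : ℝ) : ℂ) * sgnFourier H (((j : ℚ) / d : ℚ) : ℝ) * ex (x * (((j : ℚ) / d : ℚ) : ℝ)) := by
          refine Finset.sum_congr rfl fun d hd => ?_
          rw [Finset.mem_Icc] at hd
          rw [sgnCount_eq H d x hd.1 (by omega), Finset.mul_sum]
          refine Finset.sum_congr rfl fun j _ => ?_
          push_cast
          ring
      _ = ∑ p ∈ P, ((g p.1 * (1 / p.1) : ℝ) : ℂ) * sgnFourier H (((p.2 : ℚ) / p.1 : ℚ) : ℝ)
            * ex (x * (((p.2 : ℚ) / p.1 : ℚ) : ℝ)) := by rw [hP, Finset.sum_sigma]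
      _ = ∑ r ∈ farey D, ∑ p ∈ P with (p.2 : ℚ) / p.1 = r,
            ((g p.1 * (1 / p.1) : ℝ) : ℂ) * sgnFourier H (((p.2 : ℚ) / p.1 : ℚ) : ℝ)
            * ex (x * (((p.2 : ℚ) / p.1 : ℚ) : ℝ)) := by
          rw [Finset.sum_fiberwise_of_maps_to]
          intro p hp
          exact Finset.mem_image_of_mem _ hp
      _ = _ := by
          refine Finset.sum_congr rfl fun r _ => ?_
          simp only [hc]
          rw [Finset.sum_mul]
          refine Finset.sum_congr rfl fun p hp => ?_
          rw [(Finset.mem_filter.1 hp).2]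
  have hcb : ∀ r ∈ farey D, ‖c r‖ ^ 2 ≤ (K * harm D) ^ 2 * (‖sgnFourier H r‖ ^ 2 / (r.den : ℝ) ^ 2) := by
    intro r _
    have h1 : ‖c r‖ ≤ K * ‖sgnFourier H r‖ * (harm D / r.den) := by
      refine le_trans ?_ (mul_le_mul_of_nonneg_left (sum_fiber_farey_le D r) (by positivity))
      rw [Finset.mul_sum]
      refine norm_sum_le_of_le _ fun p hp => ?_
      simp only [hP, Finset.mem_filter, Finset.mem_sigma, Finset.mem_Icc] at hp
      rw [norm_mul, Complex.norm_real, Real.norm_eq_abs, abs_mul, abs_of_nonneg (a := 1 / (p.1 : ℝ)) (by positivity)]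
      have := hK p.1 hp.1.1.1 hp.1.1.2
      calc |g p.1| * (1 / (p.1 : ℝ)) * ‖sgnFourier H r‖ ≤ K * (1 / (p.1 : ℝ)) * ‖sgnFourier H r‖ := by gcongr
        _ = _ := by ring
    refine (pow_le_pow_left₀ (norm_nonneg _) h1 2).trans (le_of_eq ?_)
    ring
  have hW := sum_norm_sq_exp_sum_le (farey D) (fun r : ℚ => (r : ℝ)) c N (2 * N) _
    (fun r hr => sum_farey_norm_le D N (2 * N) hD hr)
  have hlhs : ∑ x ∈ Finset.Ioc N (2 * N), (∑ d ∈ Finset.Icc 1 D, g d * sgnCount H d x) ^ 2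
      = ∑ x ∈ Finset.Ioc N (2 * N), ‖∑ r ∈ farey D, c r * ex (x * (r : ℝ))‖ ^ 2 := by
    refine Finset.sum_congr rfl fun x hx => ?_
    rw [← hexp x hx, Complex.norm_real, Real.norm_eq_abs, sq_abs]
  rw [hlhs]
  have hN : ((2 * N - N : ℕ) : ℝ) = N := by
    congr 1
    omega
  rw [hN] at hW
  push_cast at hW
  refine hW.trans ?_
  have := harm_nonneg (D ^ 2)
  refine mul_le_mul_of_nonneg_left ?_ (by positivity)
  calc ∑ r ∈ farey D, ‖c r‖ ^ 2
      ≤ ∑ r ∈ farey D, (K * harm D) ^ 2 * (‖sgnFourier H r‖ ^ 2 / (r.den : ℝ) ^ 2) := Finset.sum_le_sum hcb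
    _ = (K * harm D) ^ 2 * ∑ r ∈ farey D, ‖sgnFourier H r‖ ^ 2 / (r.den : ℝ) ^ 2 := by rw [Finset.mul_sum]
    _ ≤ (K * harm D) ^ 2 * (8 * H * harm D ^ 2) :=
        mul_le_mul_of_nonneg_left (sum_farey_sgnFourier_le D H) (by positivity)
    _ = _ := by ring

/-- The summatory function of `g`, extended by `0` to negative integers. -/
def summ (g : ℕ → ℝ) (z : ℤ) : ℝ := ∑ d ∈ Finset.Ioc 0 z.toNat, g d

/-- The symmetric second difference of the summatory function of `g`. -/
def secondDiff (g : ℕ → ℝ) (y h : ℤ) : ℝ := summ g (y + h) - 2 * summ g y + summ g (y - h)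

lemma abs_summ_sub_le_of_le (g : ℕ → ℝ) {K : ℝ} {B a b : ℤ} (hK0 : 0 ≤ K)
    (hK : ∀ n : ℕ, 0 < n → (n : ℤ) ≤ B → |g n| ≤ K) (hab : a ≤ b) (hb : b ≤ B) :
    |summ g b - summ g a| ≤ K * (b - a) := by
  have h : summ g b - summ g a = ∑ d ∈ Finset.Ioc a.toNat b.toNat, g d := by
    rw [sub_eq_iff_eq_add, summ, summ, add_comm,
      Finset.sum_Ioc_consecutive g (Nat.zero_le _) (Int.toNat_le_toNat hab)]
  rw [h]
  have h1 : |∑ d ∈ Finset.Ioc a.toNat b.toNat, g d| ≤ ∑ d ∈ Finset.Ioc a.toNat b.toNat, K := by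
    refine (Finset.abs_sum_le_sum_abs _ _).trans (Finset.sum_le_sum fun d hd => ?_)
    rw [Finset.mem_Ioc] at hd
    exact hK d (by omega) (by omega)
  refine h1.trans ?_
  rw [Finset.sum_const, Nat.card_Ioc, nsmul_eq_mul, mul_comm]
  refine mul_le_mul_of_nonneg_left ?_ hK0
  have : ((b.toNat - a.toNat : ℕ) : ℤ) ≤ b - a := by omega
  exact_mod_cast this

lemma abs_summ_sub_le (g : ℕ → ℝ) {K : ℝ} {B a b : ℤ} (hK0 : 0 ≤ K)
    (hK : ∀ n : ℕ, 0 < n → (n : ℤ) ≤ B → |g n| ≤ K) (ha : a ≤ B) (hb : b ≤ B) (c : ℕ)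
    (hc : |a - b| ≤ c) : |summ g a - summ g b| ≤ K * c := by
  have hc' : |(a : ℝ) - b| ≤ c := by exact_mod_cast hc
  rcases le_total a b with h | h
  · rw [abs_sub_comm]
    refine (abs_summ_sub_le_of_le g hK0 hK h hb).trans (mul_le_mul_of_nonneg_left ?_ hK0)
    linarith [(abs_le.1 hc').1]
  · refine (abs_summ_sub_le_of_le g hK0 hK h ha).trans (mul_le_mul_of_nonneg_left ?_ hK0)
    linarith [(abs_le.1 hc').2]

lemma summ_succ_div (g : ℕ → ℝ) (n m : ℕ) :
    summ g ((n + 1 : ℕ) / m : ℕ) = summ g (n / m : ℕ) + if m ∣ n + 1 then g ((n + 1) / m) else 0 := by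
  simp only [summ, Int.toNat_natCast]
  rw [Nat.succ_div]
  split_ifs with h
  · rw [Finset.sum_Ioc_succ_top (Nat.zero_le _)]
  · simp

/-- Sum of `g(n/m)` over multiples `n` of `m` near `x`, weighted by the sign of `n - x`. -/
noncomputable def dilatedSum (g : ℕ → ℝ) (H m x : ℕ) : ℝ :=
  ∑ n ∈ Finset.Icc (x - H) (x + H), if m ∣ n then g (n / m) * sgn ((n : ℤ) - x) else 0

lemma dilatedSum_eq (g : ℕ → ℝ) (H m x : ℕ) (hx : H < x) :
    dilatedSum g H m x = summ g ((x + H) / m : ℕ) - summ g (x / m : ℕ)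
      - summ g ((x - 1) / m : ℕ) + summ g ((x - H - 1) / m : ℕ) := by
  rw [dilatedSum, sum_Icc_sub_add _ _ _ hx.le]
  have z : sgn 0 = 0 := by simp [sgn]
  simp only [sub_self, z, mul_zero, ite_self, zero_add]
  induction H with
  | zero => simp
  | succ H ih =>
    rw [Finset.sum_Icc_succ_top (by omega), ih (by omega), ← add_assoc x H 1, summ_succ_div g (x + H) m]
    have h2 := summ_succ_div g (x - (H + 1) - 1) m
    have e3 : x - (H + 1) - 1 + 1 = x - (H + 1) := by omega
    have e4 : x - H - 1 = x - (H + 1) := by omega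
    rw [e3] at h2
    rw [e4, h2]
    have e1 : sgn (((x + H + 1 : ℕ) : ℤ) - x) = 1 := by
      rw [sgn, if_pos]
      omega
    have e2 : sgn (((x - (H + 1) : ℕ) : ℤ) - x) = -1 := by
      rw [sgn, if_neg, if_pos] <;> omega
    rw [e1, e2]
    split_ifs <;> ring

/-- The inner sum of the symmetry integral. -/
noncomputable def symSum (g : ℕ → ℝ) (h y : ℕ) : ℝ :=
  ∑ n ∈ Finset.Icc (y - h) (y + h), g n * sgn ((n : ℤ) - (y : ℤ))

lemma abs_symSum_sub_secondDiff_le (g : ℕ → ℝ) {K : ℝ} {B : ℤ} (hK0 : 0 ≤ K)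
    (hK : ∀ n : ℕ, 0 < n → (n : ℤ) ≤ B → |g n| ≤ K) (h y : ℕ) (hy : h < y) (hB : (y : ℤ) ≤ B) :
    |symSum g h y - secondDiff g y h| ≤ 2 * K := by
  have e : symSum g h y = dilatedSum g h 1 y := by simp [symSum, dilatedSum]
  rw [e, dilatedSum_eq g h 1 y hy, secondDiff]
  simp only [Nat.div_one]
  have e1 : ((y - 1 : ℕ) : ℤ) = y - 1 := by omega
  have e2 : ((y - h - 1 : ℕ) : ℤ) = y - h - 1 := by omega
  rw [e1, e2, Nat.cast_add]
  have h1 := abs_le.1 (abs_summ_sub_le g hK0 hK (a := y) (b := y - 1) hB (by omega) 1 (by simp))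
  have h2 := abs_le.1 (abs_summ_sub_le g hK0 hK (a := (y : ℤ) - h) (b := y - h - 1) (by omega) (by omega) 1
    (by simp))
  push_cast at h1 h2
  rw [abs_le]
  constructor <;> linarith [h1.1, h1.2, h2.1, h2.2]

lemma abs_dilatedSum_sub_secondDiff_le (g : ℕ → ℝ) {K : ℝ} {B : ℤ} (hK0 : 0 ≤ K)
    (hK : ∀ n : ℕ, 0 < n → (n : ℤ) ≤ B → |g n| ≤ K) (H m x : ℕ) (hm : 0 < m) (hx : H < x)
    (hB : (x : ℤ) + H ≤ B) :
    |dilatedSum g H m x - secondDiff g (x / m : ℕ) (H / m : ℕ)| ≤ 4 * K := by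
  rw [dilatedSum_eq g H m x hx, secondDiff]
  have a0 : (x + H) / m ≤ x + H := Nat.div_le_self _ _
  have a1 : x / m + H / m ≤ (x + H) / m := Nat.div_add_div_le_add_div
  have a2 : (x + H) / m ≤ x / m + H / m + 1 := by
    rw [Nat.add_div hm]
    split_ifs <;> omega
  have b1 : (x - 1) / m ≤ x / m := Nat.div_le_div_right (by omega)
  have b2 : x / m ≤ (x - 1) / m + 1 := by
    have := @Nat.succ_div (x - 1) m
    rw [show x - 1 + 1 = x by omega] at this
    split_ifs at this <;> omega
  have c0 : x - H - 1 + (H + 1) = x := by omega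
  have c1 : (x - H - 1) / m + (H + 1) / m ≤ x / m := by
    have := @Nat.div_add_div_le_add_div (x - H - 1) (H + 1) m
    rwa [c0] at this
  have c2 : x / m ≤ (x - H - 1) / m + (H + 1) / m + 1 := by
    have := Nat.add_div (a := x - H - 1) (b := H + 1) hm
    rw [c0] at this
    split_ifs at this <;> omega
  have c3 : H / m ≤ (H + 1) / m := Nat.div_le_div_right (by omega)
  have c4 : (H + 1) / m ≤ H / m + 1 := by
    rw [Nat.succ_div]
    split_ifs <;> omega
  generalize (x + H) / m = p1 at *
  generalize x / m = p2 at *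
  generalize (x - 1) / m = p3 at *
  generalize (x - H - 1) / m = p4 at *
  generalize H / m = p5 at *
  generalize (H + 1) / m = p6 at *
  have h1 := abs_le.1 (abs_summ_sub_le g hK0 hK (a := p1) (b := (p2 : ℤ) + p5)
    (by omega) (by omega) 1 (by rw [abs_le]; constructor <;> omega))
  have h2 := abs_le.1 (abs_summ_sub_le g hK0 hK (a := p3) (b := p2)
    (by omega) (by omega) 1 (by rw [abs_le]; constructor <;> omega))
  have h3 := abs_le.1 (abs_summ_sub_le g hK0 hK (a := p4) (b := (p2 : ℤ) - p5)
    (by omega) (by omega) 2 (by rw [abs_le]; constructor <;> omega))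
  push_cast at h1 h2 h3 ⊢
  rw [abs_le]
  constructor <;> linarith [h1.1, h1.2, h2.1, h2.2, h3.1, h3.2]

lemma secondDiff_mul (g : ℕ → ℝ) (x h : ℤ) (k : ℕ) :
    secondDiff g x (k * h)
      = ∑ i ∈ Finset.range k, ∑ l ∈ Finset.range k, secondDiff g (x + i * h - l * h) h := by
  set Δ : ℤ → ℝ := fun z => summ g (z + h) - summ g z with hΔ
  have inner : ∀ i : ℕ, ∑ l ∈ Finset.range k, secondDiff g (x + i * h - l * h) h
      = Δ (x + i * h) - Δ (x + i * h - k * h) := by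
    intro i
    have := Finset.sum_range_sub' (fun l : ℕ => Δ (x + i * h - l * h)) k
    simp only [Nat.cast_zero, zero_mul, sub_zero] at this
    rw [← this]
    refine Finset.sum_congr rfl fun l _ => ?_
    have e : x + i * h - ((l + 1 : ℕ) : ℤ) * h = x + i * h - l * h - h := by
      push_cast
      ring
    simp only [hΔ, e, secondDiff, sub_add_cancel]
    ring
  have outer : ∀ z : ℤ, ∑ i ∈ Finset.range k, Δ (z + i * h) = summ g (z + k * h) - summ g z := by
    intro z
    have := Finset.sum_range_sub (fun i : ℕ => summ g (z + i * h)) k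
    simp only [Nat.cast_zero, zero_mul, add_zero] at this
    rw [← this]
    refine Finset.sum_congr rfl fun i _ => ?_
    simp only [hΔ]
    push_cast
    ring_nf
  simp only [inner, Finset.sum_sub_distrib, outer]
  have e : ∀ i : ℕ, x + i * h - k * h = (x - k * h) + i * h := fun i => by ring
  simp only [e, outer, secondDiff, sub_add_cancel]
  ring

lemma Jsgn_eq (g : ℕ → ℝ) (N H : ℕ) : Jsgn g N H = ∑ x ∈ Finset.Ioc N (2 * N), symSum g H x ^ 2 := rfl

/-- The symmetry integral at length `h` is controlled by those at length `⌊h/k⌋`. -/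
lemma Jsgn_le_of_div (g : ℕ → ℝ) {K : ℝ} (hK0 : 0 ≤ K) (M h k : ℕ) (hk : 0 < k) (hh : 0 < h)
    (hM : 4 * h ≤ M) (hK : ∀ n : ℕ, 0 < n → (n : ℤ) ≤ (3 * M : ℕ) → |g n| ≤ K) :
    Jsgn g M h ≤ 4 * (k : ℝ) ^ 4 * (Jsgn g (M / 2) (h / k) + Jsgn g (2 * (M / 2)) (h / k)
      + Jsgn g (2 * (2 * (M / 2))) (h / k)) + 48 * (k : ℝ) ^ 4 * K ^ 2 * M := by
  have hkh : k * (h / k) ≤ h := Nat.mul_div_le h k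
  have hr : h < k * (h / k) + k := by
    have := Nat.lt_mul_div_succ h hk
    rwa [mul_add, mul_one] at this
  generalize h / k = h1 at *
  have hk1 : (1 : ℝ) ≤ k := by exact_mod_cast hk
  have hsub : ∀ i < k, i * h1 + h1 ≤ k * h1 := by
    intro i hi
    calc i * h1 + h1 = (i + 1) * h1 := by ring
      _ ≤ k * h1 := Nat.mul_le_mul_right _ hi
  have hpt : ∀ x ∈ Finset.Ioc M (2 * M), symSum g h x ^ 2 ≤
      4 * (k : ℝ) ^ 2 * ∑ i ∈ Finset.range k, ∑ l ∈ Finset.range k, symSum g h1 (x + i * h1 - l * h1) ^ 2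
        + 48 * (k : ℝ) ^ 4 * K ^ 2 := by
    intro x hx
    rw [Finset.mem_Ioc] at hx
    have s1 := abs_symSum_sub_secondDiff_le g hK0 hK h x (by omega) (by push_cast; omega)
    have s2 : |secondDiff g x h - secondDiff g x (k * h1)| ≤ 2 * k * K := by
      have e1 : |(x : ℤ) + h - (x + k * h1)| ≤ k := by
        rw [abs_le]; constructor <;> zify at * <;> linarith
      have e2 : |(x : ℤ) - h - (x - k * h1)| ≤ k := by
        rw [abs_le]; constructor <;> zify at * <;> linarith
      have b0 : (k : ℤ) * h1 ≤ h := by exact_mod_cast hkh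
      have b1 : (0 : ℤ) ≤ k * h1 := by positivity
      have t1 := abs_le.1 (abs_summ_sub_le g hK0 hK (by push_cast; omega) (by push_cast; omega) k e1)
      have t2 := abs_le.1 (abs_summ_sub_le g hK0 hK (by push_cast; omega) (by push_cast; omega) k e2)
      rw [secondDiff, secondDiff, abs_le]
      constructor <;> linarith [t1.1, t1.2, t2.1, t2.2]
    have s3 : |symSum g h x| ≤ |secondDiff g x (k * h1)| + 4 * k * K := by
      have a1 := abs_le.1 s1
      have a2 := abs_le.1 s2
      have hkK : K ≤ k * K := le_mul_of_one_le_left hK0 hk1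
      have a3 := abs_le.1 (le_refl |secondDiff g x (k * h1)|)
      rw [abs_le]
      constructor <;> linarith [a1.1, a1.2, a2.1, a2.2, a3.1, a3.2]
    have s4 : symSum g h x ^ 2 ≤ 2 * secondDiff g x (k * h1) ^ 2 + 32 * (k : ℝ) ^ 2 * K ^ 2 := by
      rw [← sq_abs (symSum g h x), ← sq_abs (secondDiff g x (k * h1))]
      have := pow_le_pow_left₀ (abs_nonneg _) s3 2
      nlinarith [sq_nonneg (|secondDiff g x (k * h1)| - 4 * k * K)]
    have s5 : secondDiff g x (k * h1) ^ 2 ≤ (k : ℝ) ^ 2 * ∑ i ∈ Finset.range k, ∑ l ∈ Finset.range k,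
        secondDiff g (x + i * h1 - l * h1) h1 ^ 2 := by
      rw [secondDiff_mul]
      refine sq_sum_le_card_mul_sum_sq.trans ?_
      rw [Finset.card_range, sq (k : ℝ), mul_assoc]
      refine mul_le_mul_of_nonneg_left ?_ (by positivity)
      rw [Finset.mul_sum]
      refine Finset.sum_le_sum fun i _ => ?_
      refine sq_sum_le_card_mul_sum_sq.trans ?_
      rw [Finset.card_range]
    have s6 : ∀ i ∈ Finset.range k, ∀ l ∈ Finset.range k, secondDiff g (x + i * h1 - l * h1) h1 ^ 2
        ≤ 2 * symSum g h1 (x + i * h1 - l * h1) ^ 2 + 8 * K ^ 2 := by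
      intro i hi l hl
      have hi' := hsub i (Finset.mem_range.1 hi)
      have hl' := hsub l (Finset.mem_range.1 hl)
      have e : (((x + i * h1 - l * h1 : ℕ)) : ℤ) = x + i * h1 - l * h1 := by
        rw [Nat.cast_sub (by omega)]
        push_cast
        ring
      have := abs_symSum_sub_secondDiff_le g hK0 hK h1 (x + i * h1 - l * h1) (by omega)
        (by exact_mod_cast (by omega : x + i * h1 - l * h1 ≤ 3 * M))
      rw [e] at this
      have a1 := abs_le.1 this
      nlinarith [sq_nonneg (symSum g h1 (x + i * h1 - l * h1)
        + (symSum g h1 (x + i * h1 - l * h1) - secondDiff g (x + i * h1 - l * h1) h1)),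
        sq_le_sq' a1.1 a1.2]
    have s7 := Finset.sum_le_sum fun i hi => Finset.sum_le_sum (s6 i hi)
    simp only [Finset.sum_add_distrib, ← Finset.mul_sum, Finset.sum_const, Finset.card_range, nsmul_eq_mul] at s7
    have hk2 : (k : ℝ) ^ 2 ≤ (k : ℝ) ^ 4 := pow_le_pow_right₀ hk1 (by norm_num)
    have := mul_le_mul_of_nonneg_left s7 (by positivity : 0 ≤ (k : ℝ) ^ 2)
    nlinarith [mul_le_mul_of_nonneg_right hk2 (sq_nonneg K)]
  have hcover : ∀ i < k, ∀ l < k, ∑ x ∈ Finset.Ioc M (2 * M), symSum g h1 (x + i * h1 - l * h1) ^ 2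
      ≤ Jsgn g (M / 2) h1 + Jsgn g (2 * (M / 2)) h1 + Jsgn g (2 * (2 * (M / 2))) h1 := by
    intro i hi l hl
    have hi' := hsub i hi
    have hl' := hsub l hl
    rw [Jsgn_eq, Jsgn_eq, Jsgn_eq, Finset.sum_Ioc_consecutive _ (by omega) (by omega),
      Finset.sum_Ioc_consecutive _ (by omega) (by omega)]
    rw [← Finset.sum_image (f := fun y => symSum g h1 y ^ 2) (g := fun x => x + i * h1 - l * h1)]
    · refine Finset.sum_le_sum_of_subset_of_nonneg ?_ fun _ _ _ => sq_nonneg _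
      intro y hy
      simp only [Finset.mem_image, Finset.mem_Ioc] at hy ⊢
      obtain ⟨x, hx, rfl⟩ := hy
      omega
    · intro x hx x' hx' h
      simp only [Finset.coe_Ioc, Set.mem_Ioc] at hx hx' h
      omega
  rw [Jsgn_eq]
  refine (Finset.sum_le_sum hpt).trans ?_
  rw [Finset.sum_add_distrib, ← Finset.mul_sum, Finset.sum_const, Nat.card_Ioc, nsmul_eq_mul,
    Finset.sum_comm]
  have e : ((2 * M - M : ℕ) : ℝ) = M := by
    congr 1
    omega
  rw [e]
  have h8 : ∑ i ∈ Finset.range k, ∑ x ∈ Finset.Ioc M (2 * M), ∑ l ∈ Finset.range k,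
      symSum g h1 (x + i * h1 - l * h1) ^ 2 ≤ (k : ℝ) * (k * (Jsgn g (M / 2) h1 + Jsgn g (2 * (M / 2)) h1
        + Jsgn g (2 * (2 * (M / 2))) h1)) := by
    refine (Finset.sum_le_card_nsmul _ _ _ fun i hi => ?_).trans_eq (by rw [Finset.card_range, nsmul_eq_mul])
    rw [Finset.sum_comm]
    refine (Finset.sum_le_card_nsmul _ _ _ fun l hl => ?_).trans_eq (by rw [Finset.card_range, nsmul_eq_mul])
    exact hcover i (Finset.mem_range.1 hi) l (Finset.mem_range.1 hl)
  have := mul_le_mul_of_nonneg_left h8 (by positivity : 0 ≤ 4 * (k : ℝ) ^ 2)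
  linarith

lemma exists_forall_le_rpow {e : ℝ} (he : 0 < e) (c : ℝ) :
    ∃ M₁ : ℕ, ∀ M : ℕ, M₁ ≤ M → c ≤ (M : ℝ) ^ e := by
  have h := (tendsto_rpow_atTop he).comp (tendsto_natCast_atTop_atTop (R := ℝ))
  exact Filter.eventually_atTop.1 (h.eventually_ge_atTop c)

/-- A bound with an unspecified constant may be checked for large first argument only. -/
lemma exists_const_of_large (F W : ℕ → ℕ → ℝ) (P : ℕ → ℕ → Prop) (c : ℝ) (M₁ : ℕ)
    (hW : ∀ M h, 0 < M → 0 < h → 1 ≤ W M h) (hP : ∀ M h, 0 < M → P M h → (h : ℝ) ≤ c * M)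
    (hC : ∃ C : ℝ, 0 < C ∧ ∀ M h, M₁ ≤ M → 0 < M → 0 < h → P M h → F M h ≤ C * W M h) :
    ∃ C : ℝ, 0 < C ∧ ∀ M h, 0 < M → 0 < h → P M h → F M h ≤ C * W M h := by
  obtain ⟨C, hC0, hC⟩ := hC
  set L := ⌈|c| * M₁⌉₊ + 1 with hL
  set S := ∑ M ∈ Finset.range M₁, ∑ h ∈ Finset.range L, |F M h| with hS
  have hS0 : 0 ≤ S := Finset.sum_nonneg fun _ _ => Finset.sum_nonneg fun _ _ => abs_nonneg _
  refine ⟨C + S, by positivity, fun M h hM hh hp => ?_⟩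
  have w := hW M h hM hh
  rcases le_or_gt M₁ M with h1 | h1
  · refine (hC M h h1 hM hh hp).trans ?_
    nlinarith
  · have hhL : h < L := by
      have a : (h : ℝ) ≤ |c| * M₁ := by
        refine (hP M h hM hp).trans ?_
        have : (M : ℝ) ≤ M₁ := by exact_mod_cast h1.le
        exact mul_le_mul (le_abs_self c) this (by positivity) (abs_nonneg c)
      have : h ≤ ⌈|c| * M₁⌉₊ := by exact_mod_cast a.trans (Nat.le_ceil _)
      omega
    have : |F M h| ≤ S := by
      refine (Finset.single_le_sum (f := fun h => |F M h|) (fun _ _ => abs_nonneg _)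
        (Finset.mem_range.2 hhL)).trans ?_
      exact Finset.single_le_sum (f := fun M => ∑ h ∈ Finset.range L, |F M h|)
        (fun _ _ => Finset.sum_nonneg fun _ _ => abs_nonneg _) (Finset.mem_range.2 h1)
    have := le_abs_self (F M h)
    nlinarith

lemma EssBdd.exists_sq_bound {g : ℕ → ℝ} (hg : EssBdd g) {ε : ℝ} (hε : 0 < ε) (B : ℕ) :
    ∃ C : ℝ, 0 < C ∧ ∀ M : ℕ, 0 < M → ∃ K : ℝ, 0 ≤ K ∧
      (∀ n : ℕ, 0 < n → (n : ℤ) ≤ (B * M : ℕ) → |g n| ≤ K) ∧ K ^ 2 ≤ C * (M : ℝ) ^ ε := by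
  obtain ⟨C, hC, h⟩ := hg (ε / 2) (by positivity)
  refine ⟨C ^ 2 * ((B : ℝ) ^ ε + 1), by positivity, fun M hM =>
    ⟨C * ((B * M : ℕ) : ℝ) ^ (ε / 2), by positivity, fun n hn hn' => ?_, ?_⟩⟩
  · refine (h n hn).trans ?_
    have : (n : ℝ) ≤ ((B * M : ℕ) : ℝ) := by exact_mod_cast hn'
    gcongr
  · rw [mul_pow, ← Real.rpow_natCast (_ ^ (ε / 2)), ← Real.rpow_mul (by positivity), Nat.cast_mul,
      Real.mul_rpow (by positivity) (by positivity)]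
    have e : ε / 2 * ((2 : ℕ) : ℝ) = ε := by
      push_cast
      ring
    rw [e, mul_assoc]
    have := Real.rpow_nonneg (Nat.cast_nonneg M : (0 : ℝ) ≤ M) ε
    gcongr
    linarith

/-- Passing from lengths `h ≍ M^θ` to the range `M^θ ≤ h ≪ M^(θ+δ)`, at the cost of a power of `M^δ`. -/
lemma Jsgn_le_of_short_range {g : ℕ → ℝ} (hg : EssBdd g) {θ δ G ε c : ℝ} (hθ : 0 < θ) (hδ : 0 ≤ δ)
    (hθδ : θ + δ < 1) (hG : G ≤ 2) (hε : 0 < ε) (hc : 0 < c)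
    (hyp : ∀ c₁ c₂ : ℝ, 0 < c₁ → c₁ < c₂ →
        ∃ C : ℝ, 0 < C ∧ ∀ M h : ℕ, 0 < M → 0 < h →
          c₁ * (M : ℝ) ^ θ ≤ (h : ℝ) → (h : ℝ) ≤ c₂ * (M : ℝ) ^ θ →
          Jsgn g M h ≤ C * (M : ℝ) * (h : ℝ) ^ (2 - G)) :
    ∃ C : ℝ, 0 < C ∧ ∀ M h : ℕ, 0 < M → 0 < h →
      ((M : ℝ) ^ θ ≤ h ∧ (h : ℝ) ≤ c * (M : ℝ) ^ (θ + δ)) →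
      Jsgn g M h ≤ C * ((M : ℝ) ^ (4 * δ + ε) * ((M : ℝ) * (h : ℝ) ^ (2 - G))) := by
  obtain ⟨C0, hC0, hJ⟩ := hyp (1 / 4) 6 (by norm_num) (by norm_num)
  obtain ⟨C1, hC1, hK⟩ := hg.exists_sq_bound hε 3
  obtain ⟨M₁, hM₁⟩ := exists_forall_le_rpow (e := 1 - (θ + δ)) (by linarith) (4 * c)
  refine exists_const_of_large (fun M h => Jsgn g M h) _ _ c M₁ ?_ ?_
    ⟨c ^ 4 * (24 * C0 + 48 * C1), by positivity, ?_⟩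
  · intro M h hM hh
    have h1 : (1 : ℝ) ≤ M := by exact_mod_cast hM
    have h2 : (1 : ℝ) ≤ h := by exact_mod_cast hh
    have a1 : 1 ≤ (M : ℝ) ^ (4 * δ + ε) := Real.one_le_rpow h1 (by linarith)
    have a2 : 1 ≤ (h : ℝ) ^ (2 - G) := Real.one_le_rpow h2 (by linarith)
    exact one_le_mul_of_one_le_of_one_le a1 (one_le_mul_of_one_le_of_one_le h1 a2)
  · intro M h hM hp
    have h1 : (1 : ℝ) ≤ M := by exact_mod_cast hM
    refine hp.2.trans ?_
    have := Real.rpow_le_rpow_of_exponent_le h1 hθδ.le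
    rw [Real.rpow_one] at this
    gcongr
  · rintro M h hMM hM hh ⟨hl, hu⟩
    have h1 : (1 : ℝ) ≤ M := by exact_mod_cast hM
    have h0 : (0 : ℝ) < M := by linarith
    have hh1 : (1 : ℝ) ≤ h := by exact_mod_cast hh
    have h4 : 4 * h ≤ M := by
      have := hM₁ M hMM
      have e : (M : ℝ) = (M : ℝ) ^ (1 - (θ + δ)) * (M : ℝ) ^ (θ + δ) := by
        rw [← Real.rpow_add h0]
        simp
      have p := Real.rpow_pos_of_pos h0 (θ + δ)
      have : (4 * h : ℝ) ≤ M := by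
        rw [e]
        nlinarith
      exact_mod_cast this
    set T := (M : ℝ) ^ θ with hT
    have hT1 : 1 ≤ T := Real.one_le_rpow h1 hθ.le
    set k := ⌊(h : ℝ) / T⌋₊ with hk
    have k1 : 1 ≤ k := Nat.le_floor (by rw [Nat.cast_one, le_div_iff₀ (by linarith)]; linarith)
    have k1r : (1 : ℝ) ≤ k := by exact_mod_cast k1
    have k2 : (k : ℝ) * T ≤ h := by
      rw [← le_div_iff₀ (by linarith)]
      exact Nat.floor_le (by positivity)
    have k3 : (h : ℝ) < (k + 1) * T := by
      rw [← div_lt_iff₀ (by linarith)]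
      exact Nat.lt_floor_add_one _
    have k4 : (k : ℝ) ≤ c * (M : ℝ) ^ δ := by
      rw [Real.rpow_add h0] at hu
      have : (k : ℝ) * T ≤ (c * (M : ℝ) ^ δ) * T := by linarith
      exact le_of_mul_le_mul_right this (by linarith)
    have hkh : k ≤ h := by
      have : (k : ℝ) ≤ h := by nlinarith
      exact_mod_cast this
    obtain ⟨q, hq⟩ : ∃ q, q = h / k := ⟨_, rfl⟩
    have q1 : 1 ≤ q := by
      rw [hq]
      exact Nat.div_pos hkh k1
    have q1r : (1 : ℝ) ≤ q := by exact_mod_cast q1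
    have q2 : (k : ℝ) * q ≤ h := by
      rw [hq]
      exact_mod_cast Nat.mul_div_le h k
    have q3 : (h : ℝ) < k * (q + 1) := by
      rw [hq]
      exact_mod_cast Nat.lt_mul_div_succ h k1
    have q4 : (q : ℝ) ≤ 2 * T := by
      have : (k : ℝ) * q ≤ k * (2 * T) := by nlinarith
      exact le_of_mul_le_mul_left this (by linarith)
    have q5 : T ≤ 2 * q := by
      have : (k : ℝ) * T ≤ k * (q + 1) := by linarith
      have := le_of_mul_le_mul_left this (by linarith)
      linarith
    have q6 : (q : ℝ) ≤ h := by nlinarith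
    have hX : ∀ X : ℕ, M ≤ 3 * X → X ≤ 2 * M → Jsgn g X q ≤ 2 * C0 * M * (h : ℝ) ^ (2 - G) := by
      intro X hX1 hX2
      have x1 : (M : ℝ) ≤ 3 * X := by exact_mod_cast hX1
      have x2 : (X : ℝ) ≤ 2 * M := by exact_mod_cast hX2
      have hθ1 : θ ≤ 1 := by linarith
      have y1 : T ≤ 3 * (X : ℝ) ^ θ := by
        calc T ≤ (3 * X : ℝ) ^ θ := Real.rpow_le_rpow h0.le x1 hθ.le
          _ = 3 ^ θ * (X : ℝ) ^ θ := Real.mul_rpow (by norm_num) (by positivity)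
          _ ≤ 3 ^ (1 : ℝ) * (X : ℝ) ^ θ := by gcongr; norm_num
          _ = _ := by rw [Real.rpow_one]
      have y2 : (X : ℝ) ^ θ ≤ 2 * T := by
        calc (X : ℝ) ^ θ ≤ (2 * M : ℝ) ^ θ := Real.rpow_le_rpow (by positivity) x2 hθ.le
          _ = 2 ^ θ * (M : ℝ) ^ θ := Real.mul_rpow (by norm_num) (by positivity)
          _ ≤ 2 ^ (1 : ℝ) * (M : ℝ) ^ θ := by gcongr; norm_num
          _ = _ := by rw [Real.rpow_one]
      refine (hJ X q (by omega) (by omega) (by linarith) (by linarith)).trans ?_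
      have : (q : ℝ) ^ (2 - G) ≤ (h : ℝ) ^ (2 - G) := Real.rpow_le_rpow (by positivity) q6 (by linarith)
      calc C0 * X * (q : ℝ) ^ (2 - G) ≤ C0 * (2 * M) * (h : ℝ) ^ (2 - G) := by gcongr
        _ = _ := by ring
    obtain ⟨K, hK0, hKb, hK2⟩ := hK M hM
    have main := Jsgn_le_of_div g hK0 M h k k1 hh h4 hKb
    rw [← hq] at main
    have j1 := hX (M / 2) (by omega) (by omega)
    have j2 := hX (2 * (M / 2)) (by omega) (by omega)
    have j3 := hX (2 * (2 * (M / 2))) (by omega) (by omega)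
    set w := (h : ℝ) ^ (2 - G) with hw
    have w1 : 1 ≤ w := Real.one_le_rpow hh1 (by linarith)
    have m1 : 1 ≤ (M : ℝ) ^ ε := Real.one_le_rpow h1 hε.le
    have kk : (k : ℝ) ^ 4 ≤ c ^ 4 * (M : ℝ) ^ (4 * δ) := by
      refine (pow_le_pow_left₀ (by positivity) k4 4).trans (le_of_eq ?_)
      rw [mul_pow, ← Real.rpow_natCast (_ ^ δ), ← Real.rpow_mul h0.le]
      congr 2
      push_cast
      ring
    calc Jsgn g M h ≤ (k : ℝ) ^ 4 * (24 * C0 * M * w + 48 * K ^ 2 * M) := by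
          have k0 : 0 ≤ 4 * (k : ℝ) ^ 4 := by positivity
          have := mul_le_mul_of_nonneg_left (add_le_add (add_le_add j1 j2) j3) k0
          linarith
      _ ≤ (c ^ 4 * (M : ℝ) ^ (4 * δ)) * (24 * C0 * M * w * (M : ℝ) ^ ε + 48 * (C1 * (M : ℝ) ^ ε) * M * w) := by
          have a1 : 24 * C0 * M * w ≤ 24 * C0 * M * w * (M : ℝ) ^ ε := le_mul_of_one_le_right (by positivity) m1
          have a2 : 48 * K ^ 2 * M ≤ 48 * (C1 * (M : ℝ) ^ ε) * M * w := by
            refine le_trans ?_ (le_mul_of_one_le_right (by positivity) w1)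
            gcongr
          exact mul_le_mul kk (add_le_add a1 a2) (by positivity) (by positivity)
      _ = _ := by
          rw [Real.rpow_add h0]
          ring

/-- Uniformity in the exponent, up to an arbitrarily small power. -/
lemma Jsgn_le_uniform {g : ℕ → ℝ} (hg : EssBdd g) {θ₁ ϑ G ε c : ℝ} (hθ : 0 < θ₁) (hθϑ : θ₁ < ϑ)
    (hϑ : ϑ < 1) (hG : G ≤ 2) (hε : 0 < ε) (hc : 1 ≤ c)
    (hyp : ∀ θ : ℝ, θ₁ ≤ θ → θ ≤ ϑ → ∀ c₁ c₂ : ℝ, 0 < c₁ → c₁ < c₂ →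
        ∃ C : ℝ, 0 < C ∧ ∀ M h : ℕ, 0 < M → 0 < h →
          c₁ * (M : ℝ) ^ θ ≤ (h : ℝ) → (h : ℝ) ≤ c₂ * (M : ℝ) ^ θ →
          Jsgn g M h ≤ C * (M : ℝ) * (h : ℝ) ^ (2 - G)) :
    ∃ C : ℝ, 0 < C ∧ ∀ M h : ℕ, 0 < M → 0 < h → (M : ℝ) ^ θ₁ ≤ h → (h : ℝ) ≤ c * (M : ℝ) ^ ϑ →
      Jsgn g M h ≤ C * ((M : ℝ) ^ ε * ((M : ℝ) * (h : ℝ) ^ (2 - G))) := by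
  obtain ⟨n, hn⟩ := exists_nat_gt (8 * (ϑ - θ₁) / ε)
  have hn0 : (0 : ℝ) < n := lt_of_le_of_lt (by have := sub_pos.2 hθϑ; positivity) hn
  set δ := (ϑ - θ₁) / n with hδ
  have hδ0 : 0 < δ := div_pos (by linarith) hn0
  have hnδ : n * δ = ϑ - θ₁ := by
    rw [hδ]
    field_simp
  have hδε : 4 * δ + ε / 2 ≤ ε := by
    rw [div_lt_iff₀ hε] at hn
    have : δ * n ≤ (ε / 8) * n := by nlinarith
    have := le_of_mul_le_mul_right this hn0
    linarith
  have key : ∀ i : ℕ, i ≤ n → ∃ C : ℝ, 0 < C ∧ ∀ M h : ℕ, 0 < M → 0 < h → (M : ℝ) ^ θ₁ ≤ h →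
      (h : ℝ) ≤ c * (M : ℝ) ^ (θ₁ + i * δ) →
      Jsgn g M h ≤ C * ((M : ℝ) ^ ε * ((M : ℝ) * (h : ℝ) ^ (2 - G))) := by
    intro i
    induction i with
    | zero =>
      intro _
      obtain ⟨C, hC, h⟩ := Jsgn_le_of_short_range hg hθ le_rfl (by linarith : θ₁ + 0 < 1) hG hε
        (by linarith : 0 < c) (hyp θ₁ le_rfl hθϑ.le)
      refine ⟨C, hC, fun M k hM hk h1 h2 => ?_⟩
      have := h M k hM hk ⟨h1, by simpa using h2⟩
      simpa using this
    | succ i ih =>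
      intro hi
      obtain ⟨C, hC, h⟩ := ih (by omega)
      have hiδ : ((i + 1 : ℕ) : ℝ) * δ ≤ ϑ - θ₁ := by
        rw [← hnδ]
        have : ((i + 1 : ℕ) : ℝ) ≤ n := by exact_mod_cast hi
        gcongr
      push_cast at hiδ
      have hi0 : 0 ≤ (i : ℝ) * δ := by positivity
      obtain ⟨C', hC', h'⟩ := Jsgn_le_of_short_range hg (θ := θ₁ + i * δ) (by linarith) hδ0.le
        (by linarith) hG (half_pos hε) (by linarith : 0 < c) (hyp _ (by linarith) (by linarith))
      refine ⟨C + C', by positivity, fun M k hM hk h1 h2 => ?_⟩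
      have hM1 : (1 : ℝ) ≤ M := by exact_mod_cast hM
      have hnn : 0 ≤ (M : ℝ) ^ ε * ((M : ℝ) * (k : ℝ) ^ (2 - G)) := by positivity
      have hp := Real.rpow_nonneg (by linarith : (0 : ℝ) ≤ M) (θ₁ + i * δ)
      rcases le_total (k : ℝ) ((M : ℝ) ^ (θ₁ + i * δ)) with h3 | h3
      · have := h M k hM hk h1 (h3.trans (by nlinarith))
        nlinarith
      · have e : θ₁ + ((i + 1 : ℕ) : ℝ) * δ = θ₁ + i * δ + δ := by
          push_cast
          ring
        have a := h' M k hM hk ⟨h3, by rwa [← e]⟩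
        have b : (M : ℝ) ^ (4 * δ + ε / 2) ≤ (M : ℝ) ^ ε := Real.rpow_le_rpow_of_exponent_le hM1 hδε
        have d : C' * ((M : ℝ) ^ (4 * δ + ε / 2) * ((M : ℝ) * (k : ℝ) ^ (2 - G)))
            ≤ C' * ((M : ℝ) ^ ε * ((M : ℝ) * (k : ℝ) ^ (2 - G))) := by gcongr
        nlinarith
  obtain ⟨C, hC, h⟩ := key n le_rfl
  refine ⟨C, hC, fun M k hM hk h1 h2 => h M k hM hk h1 ?_⟩
  rwa [hnδ, add_sub_cancel]

open Finset in
lemma sum_divisors_split (g : ℕ → ℝ) (D X n : ℕ) (hD : 0 < D) (hn : 0 < n) (hX : n ≤ X) :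
    ∑ d ∈ n.divisors, g d = ∑ d ∈ Icc 1 D, (if d ∣ n then g d else 0)
      + ∑ m ∈ Icc 1 (X / D), if m ∣ n ∧ m * D < n then g (n / m) else 0 := by
  have h1 : ∑ d ∈ Icc 1 D, (if d ∣ n then g d else 0) = ∑ d ∈ n.divisors, if d ≤ D then g d else 0 := by
    rw [← sum_filter, ← sum_filter]
    refine sum_congr ?_ fun _ _ => rfl
    ext d
    simp only [mem_filter, mem_Icc, Nat.mem_divisors]
    refine ⟨fun h => ⟨⟨h.2, hn.ne'⟩, h.1.2⟩, fun h => ⟨⟨Nat.pos_of_dvd_of_pos h.1.1 hn, h.2⟩, h.1.1⟩⟩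
  have h2 : ∑ m ∈ Icc 1 (X / D), (if m ∣ n ∧ m * D < n then g (n / m) else 0)
      = ∑ d ∈ n.divisors, if d ≤ D then 0 else g d := by
    rw [← Nat.sum_div_divisors n (fun d => if d ≤ D then 0 else g d)]
    rw [← sum_filter]
    have : ∀ m ∈ n.divisors, (if n / m ≤ D then 0 else g (n / m)) = if m * D < n then g (n / m) else 0 := by
      intro m hm
      obtain ⟨⟨k, rfl⟩, -⟩ := Nat.mem_divisors.1 hm
      have hm0 : 0 < m := Nat.pos_of_mul_pos_right hn
      rw [Nat.mul_div_cancel_left _ hm0]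
      by_cases h : k ≤ D
      · rw [if_pos h, if_neg]
        exact not_lt.2 (Nat.mul_le_mul_left _ h)
      · rw [if_neg h, if_pos]
        exact Nat.mul_lt_mul_of_pos_left (not_le.1 h) hm0
    rw [sum_congr rfl this, ← sum_filter]
    refine sum_congr ?_ fun _ _ => rfl
    ext m
    simp only [mem_filter, mem_Icc, Nat.mem_divisors]
    refine ⟨fun h => ⟨⟨h.2.1, hn.ne'⟩, h.2.2⟩, fun h => ⟨⟨Nat.pos_of_dvd_of_pos h.1.1 hn, ?_⟩, h.1.1, h.2⟩⟩
    rw [Nat.le_div_iff_mul_le hD]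
    omega
  rw [h1, h2, ← sum_add_distrib]
  refine sum_congr rfl fun d _ => ?_
  split_ifs <;> simp

/-- The part of `dilatedSum` over `n > m D`. -/
noncomputable def truncSum (g : ℕ → ℝ) (D H m x : ℕ) : ℝ :=
  ∑ n ∈ Finset.Icc (x - H) (x + H), if m ∣ n ∧ m * D < n then g (n / m) * sgn ((n : ℤ) - x) else 0

open Finset in
lemma symSum_sum_divisors (g : ℕ → ℝ) (D X H x : ℕ) (hD : 0 < D) (hx : H < x) (hX : x + H ≤ X) :
    symSum (fun n => ∑ d ∈ n.divisors, g d) H x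
      = ∑ d ∈ Icc 1 D, g d * sgnCount H d x + ∑ m ∈ Icc 1 (X / D), truncSum g D H m x := by
  simp only [symSum, sgnCount, truncSum, mul_sum]
  rw [sum_comm (s := Icc 1 D), sum_comm (s := Icc 1 (X / D)), ← sum_add_distrib]
  refine sum_congr rfl fun n hn => ?_
  rw [mem_Icc] at hn
  rw [sum_divisors_split g D X n hD (by omega) (by omega), add_mul, sum_mul, sum_mul]
  congr 1
  · refine sum_congr rfl fun d _ => ?_
    split_ifs <;> simp
  · refine sum_congr rfl fun m _ => ?_
    split_ifs <;> simp

lemma abs_sgn_le (t : ℤ) : |sgn t| ≤ 1 := by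
  rw [sgn]
  split_ifs <;> simp

lemma card_filter_mul_mem_le (S : Finset ℕ) (D a b : ℕ) (hD : 0 < D) :
    (S.filter fun k => a ≤ k * D ∧ k * D ≤ b).card ≤ (b - a) / D + 1 := by
  set s := S.filter fun k => a ≤ k * D ∧ k * D ≤ b with hs
  rcases s.eq_empty_or_nonempty with h | h
  · simp [h]
  have h0 := (Finset.mem_filter.1 (s.min'_mem h)).2
  have h1 := (Finset.mem_filter.1 (s.max'_mem h)).2
  have hsub : s ⊆ Finset.Icc (s.min' h) (s.max' h) := fun k hk =>
    Finset.mem_Icc.2 ⟨s.min'_le k hk, s.le_max' k hk⟩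
  have hle := s.min'_le_max' h
  refine (Finset.card_le_card hsub).trans ?_
  rw [Nat.card_Icc]
  have : s.max' h - s.min' h ≤ (b - a) / D := by
    rw [Nat.le_div_iff_mul_le hD, Nat.sub_mul]
    omega
  omega

lemma card_filter_dvd_Icc_le (m a b : ℕ) (hm : 0 < m) :
    ((Finset.Icc a b).filter (m ∣ ·)).card ≤ (b - a) / m + 1 := by
  refine le_trans ?_ (card_filter_mul_mem_le (((Finset.Icc a b).filter (m ∣ ·)).image (· / m)) m a b hm)
  refine Finset.card_le_card_of_injOn (· / m) ?_ ?_
  · intro n hn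
    have hn' := Finset.mem_filter.1 hn
    have hab := Finset.mem_Icc.1 hn'.1
    refine Finset.mem_coe.2 (Finset.mem_filter.2 ⟨Finset.mem_image_of_mem _ hn, ?_⟩)
    rwa [Nat.div_mul_cancel hn'.2]
  · intro n hn k hk h
    have h1 := Nat.div_mul_cancel (Finset.mem_filter.1 hn).2
    have h2 := Nat.div_mul_cancel (Finset.mem_filter.1 hk).2
    simp only at h
    rw [← h1, ← h2, h]

lemma abs_truncSum_le (g : ℕ → ℝ) {K : ℝ} {B : ℤ} (hK0 : 0 ≤ K)
    (hK : ∀ n : ℕ, 0 < n → (n : ℤ) ≤ B → |g n| ≤ K) (D H m x : ℕ) (hm : 0 < m) (hx : H < x)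
    (hB : (x : ℤ) + H ≤ B) :
    |truncSum g D H m x| ≤ |dilatedSum g H m x| +
      if x - H ≤ m * D ∧ m * D ≤ x + H then K * (2 * H / m + 1) else 0 := by
  split_ifs with h
  · have h1 : |truncSum g D H m x| ≤ ∑ n ∈ Finset.Icc (x - H) (x + H), if m ∣ n then K else 0 := by
      refine (Finset.abs_sum_le_sum_abs _ _).trans (Finset.sum_le_sum fun n hn => ?_)
      rw [Finset.mem_Icc] at hn
      by_cases hd : m ∣ n
      · rw [if_pos hd]
        split_ifs
        · rw [abs_mul]
          have hp : 0 < n / m := Nat.div_pos (Nat.le_of_dvd (by omega) hd) hm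
          have hq : n / m ≤ n := Nat.div_le_self _ _
          have := mul_le_mul (hK (n / m) hp (by omega)) (abs_sgn_le ((n : ℤ) - x)) (abs_nonneg _) hK0
          rwa [mul_one] at this
        · simpa using hK0
      · simp [hd]
    rw [← Finset.sum_filter, Finset.sum_const, nsmul_eq_mul, mul_comm] at h1
    have h2 := card_filter_dvd_Icc_le m (x - H) (x + H) hm
    have e : x + H - (x - H) = 2 * H := by omega
    rw [e] at h2
    have h3 : (((Finset.Icc (x - H) (x + H)).filter (m ∣ ·)).card : ℝ) ≤ 2 * H / m + 1 := by
      refine (Nat.cast_le.2 h2).trans ?_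
      push_cast
      have := @Nat.cast_div_le ℝ _ _ _ (2 * H) m
      push_cast at this
      linarith
    have := mul_le_mul_of_nonneg_left h3 hK0
    have := abs_nonneg (dilatedSum g H m x)
    linarith
  · rw [add_zero]
    by_cases h1 : m * D < x - H
    · refine le_of_eq (congrArg abs (Finset.sum_congr rfl fun n hn => ?_))
      rw [Finset.mem_Icc] at hn
      have : m * D < n := by omega
      simp [this]
    · have : truncSum g D H m x = 0 := Finset.sum_eq_zero fun n hn => by
        rw [Finset.mem_Icc] at hn
        rw [if_neg]
        omega
      rw [this, abs_zero]
      exact abs_nonneg _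

open Finset in
/-- Only few boundary terms occur, and each has few summands. -/
lemma sum_abs_truncSum_le (g : ℕ → ℝ) {K : ℝ} {B : ℤ} (hK0 : 0 ≤ K)
    (hK : ∀ n : ℕ, 0 < n → (n : ℤ) ≤ B → |g n| ≤ K) (D H Q N x : ℕ) (hD : 0 < D) (hN : 0 < N)
    (hx : N < x) (hH : 4 * H ≤ N) (hB : (x : ℤ) + H ≤ B) :
    ∑ m ∈ Icc 1 Q, |truncSum g D H m x| ≤ ∑ m ∈ Icc 1 Q, |dilatedSum g H m x| +
      K * (2 * H / D + 1) * (4 * H * D / N + 1) := by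
  have h1 : ∑ m ∈ Icc 1 Q, |truncSum g D H m x| ≤ ∑ m ∈ Icc 1 Q, (|dilatedSum g H m x| +
      if x - H ≤ m * D ∧ m * D ≤ x + H then K * (4 * H * D / N + 1) else 0) := by
    refine sum_le_sum fun m hm => ?_
    have hm0 : 0 < m := (mem_Icc.1 hm).1
    refine (abs_truncSum_le g hK0 hK D H m x hm0 (by omega) hB).trans (add_le_add le_rfl ?_)
    split_ifs with h
    · have hmN : (N : ℝ) ≤ 2 * (m * D) := by
        have : N ≤ 2 * (m * D) := by omega
        exact_mod_cast this
      have : (2 * H / m : ℝ) ≤ 4 * H * D / N := by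
        have a : (0 : ℝ) < m := by exact_mod_cast hm0
        have b : (0 : ℝ) < N := by exact_mod_cast hN
        rw [div_le_div_iff₀ a b]
        have := mul_le_mul_of_nonneg_left hmN (by positivity : (0 : ℝ) ≤ 2 * H)
        linarith
      gcongr
    · exact le_rfl
  refine h1.trans ?_
  rw [sum_add_distrib, ← sum_filter, sum_const, nsmul_eq_mul]
  have h2 := card_filter_mul_mem_le (Icc 1 Q) D (x - H) (x + H) hD
  have e : x + H - (x - H) = 2 * H := by omega
  rw [e] at h2
  have h3 : (((Icc 1 Q).filter fun k => x - H ≤ k * D ∧ k * D ≤ x + H).card : ℝ) ≤ 2 * H / D + 1 := by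
    refine (Nat.cast_le.2 h2).trans ?_
    push_cast
    have := @Nat.cast_div_le ℝ _ _ _ (2 * H) D
    push_cast at this
    linarith
  have h4 : 0 ≤ K * (4 * H * D / N + 1 : ℝ) := by positivity
  have := mul_le_mul_of_nonneg_right h3 h4
  linarith

open Finset in
lemma sum_abs_sq_le_harm (a : ℕ → ℝ) (Q : ℕ) :
    (∑ m ∈ Icc 1 Q, |a m|) ^ 2 ≤ harm Q * ∑ m ∈ Icc 1 Q, m * a m ^ 2 := by
  refine sum_sq_le_sum_mul_sum_of_sq_le_mul _ (fun _ _ => by positivity) (fun _ _ => by positivity) ?_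
  intro m hm
  have : (m : ℝ) ≠ 0 := by
    have := (mem_Icc.1 hm).1
    positivity
  rw [sq_abs]
  exact le_of_eq (by field_simp)

open Finset in
lemma sum_Ioc_comp_div_le (φ : ℕ → ℝ) (hφ : ∀ y, 0 ≤ φ y) (N m : ℕ) (hm : 0 < m) (hM : 3 ≤ N / m) :
    ∑ x ∈ Ioc N (2 * N), φ (x / m) ≤ m * (∑ y ∈ Ioc (N / m - 1) (2 * (N / m - 1)), φ y
      + ∑ y ∈ Ioc (2 * (N / m - 1)) (2 * (2 * (N / m - 1))), φ y) := by
  rw [sum_Ioc_consecutive _ (by omega) (by omega)]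
  set M := N / m with hMd
  have maps : ∀ x ∈ Ioc N (2 * N), x / m ∈ Ioc (M - 1) (2 * (2 * (M - 1))) := by
    intro x hx
    rw [mem_Ioc] at hx ⊢
    have h1 : M ≤ x / m := Nat.div_le_div_right hx.1.le
    have h2 : x / m ≤ 2 * N / m := Nat.div_le_div_right hx.2
    have h3 : 2 * N / m < 2 * M + 2 := by
      rw [Nat.div_lt_iff_lt_mul hm]
      have := Nat.lt_mul_div_succ N hm
      rw [← hMd] at this
      nlinarith
    omega
  rw [← sum_fiberwise_of_maps_to maps, mul_sum]
  refine sum_le_sum fun y _ => ?_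
  have h1 : ∑ x ∈ Ioc N (2 * N) with x / m = y, φ (x / m) = ∑ x ∈ Ioc N (2 * N) with x / m = y, φ y :=
    sum_congr rfl fun x hx => by rw [(mem_filter.1 hx).2]
  rw [h1, sum_const, nsmul_eq_mul]
  refine mul_le_mul_of_nonneg_right ?_ (hφ y)
  have hsub : (Ioc N (2 * N)).filter (fun x => x / m = y) ⊆ Ico (y * m) (y * m + m) := by
    intro x hx
    have hx' := (mem_filter.1 hx).2
    rw [mem_Ico, ← hx']
    exact ⟨Nat.div_mul_le_self x m, Nat.lt_div_mul_add hm⟩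
  have := card_le_card hsub
  rw [Nat.card_Ico] at this
  have : ((Ioc N (2 * N)).filter (fun x => x / m = y)).card ≤ m := by omega
  exact_mod_cast this

open Finset in
lemma sum_dilatedSum_sq_le (g : ℕ → ℝ) {K : ℝ} {N H m : ℕ} (hK0 : 0 ≤ K)
    (hK : ∀ n : ℕ, 0 < n → (n : ℤ) ≤ (3 * N : ℕ) → |g n| ≤ K) (hm : 0 < m) (hM : 3 ≤ N / m)
    (hH : 4 * H ≤ N) :
    ∑ x ∈ Ioc N (2 * N), dilatedSum g H m x ^ 2
      ≤ 2 * m * (Jsgn g (N / m - 1) (H / m) + Jsgn g (2 * (N / m - 1)) (H / m)) + 72 * K ^ 2 * N := by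
  have h1 : ∀ x ∈ Ioc N (2 * N), dilatedSum g H m x ^ 2 ≤ 2 * symSum g (H / m) (x / m) ^ 2 + 72 * K ^ 2 := by
    intro x hx
    rw [mem_Ioc] at hx
    have h0 : 1 ≤ N := by
      rcases Nat.eq_zero_or_pos N with rfl | h
      · simp at hM
      · exact h
    have a0 : N / m ≤ x / m := Nat.div_le_div_right hx.1.le
    have a1 : 4 * (H / m) ≤ N / m := (Nat.mul_div_le_mul_div_assoc 4 H m).trans (Nat.div_le_div_right hH)
    have a2 : x / m ≤ x := Nat.div_le_self _ _
    have b1 := abs_le.1 (abs_dilatedSum_sub_secondDiff_le g hK0 hK H m x hm (by omega) (by omega))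
    have b2 := abs_le.1 (abs_symSum_sub_secondDiff_le g hK0 hK (H / m) (x / m) (by omega) (by omega))
    set u := dilatedSum g H m x
    set v := symSum g (H / m) (x / m)
    have c : |u - v| ≤ 6 * K := abs_le.2 ⟨by linarith [b1.1, b2.2], by linarith [b1.2, b2.1]⟩
    have c2 := sq_le_sq' (abs_le.1 c).1 (abs_le.1 c).2
    nlinarith [sq_nonneg (u - 2 * v)]
  refine (sum_le_sum h1).trans ?_
  rw [sum_add_distrib, ← mul_sum, sum_const, Nat.card_Ioc, nsmul_eq_mul, Jsgn_eq, Jsgn_eq]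
  have h2 := sum_Ioc_comp_div_le (fun y => symSum g (H / m) y ^ 2) (fun _ => sq_nonneg _) N m hm hM
  have e : ((2 * N - N : ℕ) : ℝ) = N := by
    congr 1
    omega
  rw [e]
  linarith

open Finset in
/-- The hyperbola method, with the large sieve for small divisors and the dilated symmetry
integrals of `g` for large ones. -/
lemma Jsgn_sum_divisors_le (g : ℕ → ℝ) {K : ℝ} {N H D : ℕ} (hK0 : 0 ≤ K)
    (hK : ∀ n : ℕ, 0 < n → (n : ℤ) ≤ (3 * N : ℕ) → |g n| ≤ K) (hN : 0 < N) (hD : 0 < D)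
    (hDN : D ≤ N) (hH : 4 * H ≤ N) (hQ : 3 * (3 * N / D) ≤ N) :
    Jsgn (fun n => ∑ d ∈ n.divisors, g d) N H
      ≤ 3 * ((N + 2 * (D : ℝ) ^ 2 * harm (D ^ 2)) * (8 * H * K ^ 2 * harm D ^ 4))
      + 3 * (harm (3 * N / D) * ∑ m ∈ Icc 1 (3 * N / D), m * (2 * m * (Jsgn g (N / m - 1) (H / m)
        + Jsgn g (2 * (N / m - 1)) (H / m)) + 72 * K ^ 2 * N))
      + 3 * (N * (K * (2 * H / D + 1) * (4 * H * D / N + 1)) ^ 2) := by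
  set E := K * (2 * H / D + 1) * (4 * H * D / N + 1 : ℝ) with hE
  set Q := 3 * N / D with hQd
  have pt : ∀ x ∈ Ioc N (2 * N), symSum (fun n => ∑ d ∈ n.divisors, g d) H x ^ 2
      ≤ 3 * (∑ d ∈ Icc 1 D, g d * sgnCount H d x) ^ 2
        + 3 * (harm Q * ∑ m ∈ Icc 1 Q, m * dilatedSum g H m x ^ 2) + 3 * E ^ 2 := by
    intro x hx
    rw [mem_Ioc] at hx
    rw [symSum_sum_divisors g D (3 * N) H x hD (by omega) (by omega)]
    have h1 := sum_abs_truncSum_le g hK0 hK D H Q N x hD hN hx.1 hH (by omega)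
    have h2 := (abs_sum_le_sum_abs (fun m => truncSum g D H m x) (Icc 1 Q)).trans h1
    have h3 := sum_abs_sq_le_harm (fun m => dilatedSum g H m x) Q
    set L := ∑ d ∈ Icc 1 D, g d * sgnCount H d x
    set T := ∑ m ∈ Icc 1 Q, truncSum g D H m x
    set A := ∑ m ∈ Icc 1 Q, |dilatedSum g H m x|
    have h4 : T ^ 2 ≤ (A + E) ^ 2 := sq_le_sq' (abs_le.1 h2).1 (abs_le.1 h2).2
    have h5 : (L + T) ^ 2 ≤ (|L| + (A + E)) ^ 2 := by
      refine sq_le_sq' ?_ ?_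
      · linarith [(abs_le.1 h2).1, neg_abs_le L]
      · linarith [(abs_le.1 h2).2, le_abs_self L]
    have h6 : (|L| + (A + E)) ^ 2 ≤ 3 * L ^ 2 + 3 * A ^ 2 + 3 * E ^ 2 := by
      rw [← sq_abs L]
      nlinarith [sq_nonneg (|L| - A), sq_nonneg (|L| - E), sq_nonneg (A - E)]
    linarith
  rw [Jsgn_eq]
  refine (sum_le_sum pt).trans ?_
  rw [sum_add_distrib, sum_add_distrib, ← mul_sum, ← mul_sum, ← mul_sum, sum_const, Nat.card_Ioc,
    nsmul_eq_mul, sum_comm]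
  have e : ((2 * N - N : ℕ) : ℝ) = N := by
    congr 1
    omega
  rw [e]
  have ls := sum_sq_sum_sgnCount_le g D N H K hD (by omega) fun d hd hdD => hK d hd (by omega)
  have dl : ∑ m ∈ Icc 1 Q, ∑ x ∈ Ioc N (2 * N), (m : ℝ) * dilatedSum g H m x ^ 2
      ≤ ∑ m ∈ Icc 1 Q, m * (2 * m * (Jsgn g (N / m - 1) (H / m)
        + Jsgn g (2 * (N / m - 1)) (H / m)) + 72 * K ^ 2 * N) := by
    refine sum_le_sum fun m hm => ?_
    rw [mem_Icc] at hm
    rw [← mul_sum]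
    refine mul_le_mul_of_nonneg_left (sum_dilatedSum_sq_le g hK0 hK hm.1 ?_ hH) (by positivity)
    rw [Nat.le_div_iff_mul_le hm.1]
    omega
  have dl' := mul_le_mul_of_nonneg_left dl (harm_nonneg Q)
  linarith

lemma exists_parameters {ϑ G G' : ℝ} (hϑ1 : 1 / 3 < ϑ) (hϑ2 : ϑ < 1) (hG1 : 0 < G) (hG2 : G < 1)
    (hG' : 0 < G') (h1 : ϑ * G' * (G + 2) < G * (3 * ϑ - 1)) (h2 : ϑ * (1 + G') < 1) :
    ∃ κ θ₁ η : ℝ, 0 < κ ∧ κ < ϑ ∧ 0 < θ₁ ∧ θ₁ < ϑ ∧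
      (3 * ϑ - 1) / ((1 - G) * ϑ + G + 1) < θ₁ ∧ θ₁ * (1 - κ) < ϑ - κ ∧ 0 < η ∧ η < 1 ∧
      ϑ + 5 * η ≤ ϑ * (2 - G') ∧ 1 - 2 * κ + ϑ + 7 * η ≤ ϑ * (2 - G') ∧
      ϑ * (2 - G) + κ * G + 3 * η ≤ ϑ * (2 - G') ∧ 2 * κ + 2 * η ≤ ϑ * (2 - G') ∧
      2 * (ϑ - κ) + η ≤ ϑ * (2 - G') ∧ 4 * ϑ - 2 + η ≤ ϑ * (2 - G') := by
  have hϑ0 : 0 < ϑ := by linarith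
  have k1 : (1 - ϑ + ϑ * G') / 2 < (1 - (1 - G) * ϑ) / (2 + G) := by
    rw [div_lt_div_iff₀ (by norm_num) (by linarith)]
    nlinarith
  have k2 : (1 - ϑ + ϑ * G') / 2 < ϑ * (1 - G' / G) := by
    have : ϑ * (1 - G' / G) = ϑ * (G - G') / G := by field_simp
    rw [this, div_lt_div_iff₀ (by norm_num) hG1]
    nlinarith
  obtain ⟨κ, hκ1, hκ⟩ := exists_between (lt_min k1 k2)
  obtain ⟨hκ2, hκ3⟩ := lt_min_iff.1 hκ
  have hGG : ϑ * (1 - G' / G) = ϑ * (G - G') / G := by field_simp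
  rw [hGG, lt_div_iff₀ hG1] at hκ3
  rw [lt_div_iff₀ (by linarith)] at hκ2
  have hϑG' : 0 < ϑ * G' := by positivity
  have hκ0 : 0 < κ := by linarith
  have hκϑ : κ < ϑ := by nlinarith
  have hd : 0 < (1 - G) * ϑ + G + 1 := by nlinarith
  have t : (3 * ϑ - 1) / ((1 - G) * ϑ + G + 1) < (ϑ - κ) / (1 - κ) := by
    rw [div_lt_div_iff₀ hd (by linarith)]
    have : 0 < (1 - ϑ) * (1 - (1 - G) * ϑ - κ * (2 + G)) := mul_pos (by linarith) (by linarith)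
    nlinarith
  obtain ⟨θ₁, hθ1, hθ2⟩ := exists_between t
  have hθ0 : 0 < θ₁ := lt_trans (div_pos (by linarith) hd) hθ1
  rw [lt_div_iff₀ (by linarith)] at hθ2
  have hθϑ : θ₁ < ϑ := by
    by_contra! h
    nlinarith
  have hG'1 : ϑ * G' < ϑ := by
    have : ϑ * G' * (G + 2) < ϑ * (G + 2) := by nlinarith
    exact lt_of_mul_lt_mul_right this (by linarith)
  have hGκ : ϑ * G' + κ < ϑ := by
    have : (ϑ * G' + κ) * G < ϑ * G := by nlinarith
    exact lt_of_mul_lt_mul_right this hG1.le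
  have s1 : 0 < ϑ * (1 - G') := by linarith
  have s2 : 0 < 2 * κ - (1 - ϑ + ϑ * G') := by linarith
  have s3 : 0 < ϑ * (G - G') - κ * G := by linarith
  have s4 : 0 < ϑ * (2 - G') - 2 * κ := by
    have : ϑ * G' / 2 + κ < ϑ := by linarith
    linarith
  have s5 : 0 < 2 - 2 * ϑ - ϑ * G' := by linarith
  obtain ⟨η, hη0, hη⟩ := exists_between (lt_min (lt_min (lt_min s1 s2) (lt_min s3 s4)) (lt_min s5 one_pos))
  simp only [lt_min_iff] at hη
  refine ⟨κ, θ₁, η / 7, hκ0, hκϑ, hθ0, hθϑ, hθ1, hθ2, by linarith, by linarith, ?_, ?_, ?_, ?_, ?_, ?_⟩ <;>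
  linarith [hη.1.1.1, hη.1.1.2, hη.1.2.1, hη.1.2.2, hη.2.1, hη.2.2]

lemma Jsgn_div_le {g : ℕ → ℝ} {θ₁ ϑ G η κ c₁ c₂ C : ℝ} (hθ0 : 0 < θ₁) (hθ1 : θ₁ < 1) (hϑ0 : 0 < ϑ)
    (hϑ1 : ϑ < 1) (hG0 : 0 < G) (hG1 : G < 1) (hη0 : 0 < η) (hη1 : η < 1) (hc₁ : 0 < c₁) (hC : 0 < C)
    (hJ : ∀ M h : ℕ, 0 < M → 0 < h → (M : ℝ) ^ θ₁ ≤ h → (h : ℝ) ≤ max 1 (2 * c₂) * (M : ℝ) ^ ϑ →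
      Jsgn g M h ≤ C * ((M : ℝ) ^ η * ((M : ℝ) * (h : ℝ) ^ (2 - G))))
    {N H m M : ℕ} (hm : 0 < m) (hmQ : (m : ℝ) ≤ 6 * (N : ℝ) ^ κ) (hNm : 3 ≤ N / m) (hmH : m ≤ H)
    (hl : c₁ * (N : ℝ) ^ ϑ ≤ H) (hu : (H : ℝ) ≤ c₂ * (N : ℝ) ^ ϑ)
    (hbig : 24 / c₁ ≤ (N : ℝ) ^ (ϑ - κ - θ₁ * (1 - κ))) (hM1 : N / m - 1 ≤ M)
    (hM2 : M ≤ 2 * (N / m - 1)) :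
    Jsgn g M (H / m) ≤ 24 * C * ((N : ℝ) ^ (1 + κ * G + η) * (H : ℝ) ^ (2 - G)) / (m : ℝ) ^ 3 := by
  have hN : 0 < N := by
    rcases Nat.eq_zero_or_pos N with rfl | h
    · simp at hNm
    · exact h
  set X := (N : ℝ) with hX
  have hX1 : 1 ≤ X := Nat.one_le_cast.2 hN
  have hX0 : 0 < X := by linarith
  have hm1 : (1 : ℝ) ≤ m := by exact_mod_cast hm
  have hm0 : (0 : ℝ) < m := by linarith
  set h := H / m with hh
  have h0 : 0 < h := Nat.div_pos hmH hm
  have hh1 : (h : ℝ) ≤ H / m := Nat.cast_div_le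
  have hh2 : (H : ℝ) / m ≤ 2 * h := by
    rw [div_le_iff₀ hm0]
    have : H < m * (H / m + 1) := Nat.lt_mul_div_succ H hm
    have : H ≤ 2 * h * m := by
      rw [← hh] at this
      nlinarith
    exact_mod_cast this
  have hM3 : (M : ℝ) ≤ 2 * X / m := by
    rw [le_div_iff₀ hm0]
    have : N / m * m ≤ N := Nat.div_mul_le_self N m
    have a : M ≤ 2 * (N / m) := by omega
    have : M * m ≤ 2 * N := by nlinarith
    have : (M * m : ℝ) ≤ 2 * N := by exact_mod_cast this
    exact this
  have hM4 : X / m ≤ 2 * M := by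
    rw [div_le_iff₀ hm0]
    have : N < m * (N / m + 1) := Nat.lt_mul_div_succ N hm
    have a : N / m + 1 ≤ 2 * M := by omega
    have : N ≤ 2 * M * m := by nlinarith
    have : (N : ℝ) ≤ 2 * M * m := by exact_mod_cast this
    exact this
  have key : (M : ℝ) ^ θ₁ ≤ h := by
    have a1 : (M : ℝ) ^ θ₁ ≤ 2 * (X ^ θ₁ / (m : ℝ) ^ θ₁) := by
      calc (M : ℝ) ^ θ₁ ≤ (2 * (X / m)) ^ θ₁ := by
            rw [← mul_div_assoc]
            exact Real.rpow_le_rpow (by positivity) hM3 hθ0.le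
        _ = 2 ^ θ₁ * (X ^ θ₁ / (m : ℝ) ^ θ₁) := by
            rw [Real.mul_rpow (by norm_num) (by positivity), Real.div_rpow hX0.le hm0.le]
        _ ≤ 2 ^ (1 : ℝ) * (X ^ θ₁ / (m : ℝ) ^ θ₁) := by gcongr; norm_num
        _ = _ := by rw [Real.rpow_one]
    have a2 : (m : ℝ) ^ (1 - θ₁) ≤ 6 * X ^ (κ * (1 - θ₁)) := by
      calc (m : ℝ) ^ (1 - θ₁) ≤ (6 * X ^ κ) ^ (1 - θ₁) := Real.rpow_le_rpow hm0.le hmQ (by linarith)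
        _ = 6 ^ (1 - θ₁) * X ^ (κ * (1 - θ₁)) := by
            rw [Real.mul_rpow (by norm_num) (by positivity), Real.rpow_mul hX0.le]
        _ ≤ 6 ^ (1 : ℝ) * X ^ (κ * (1 - θ₁)) := by gcongr <;> linarith
        _ = _ := by rw [Real.rpow_one]
    have a3 : X ^ ϑ = X ^ (ϑ - κ - θ₁ * (1 - κ)) * (X ^ θ₁ * X ^ (κ * (1 - θ₁))) := by
      rw [← Real.rpow_add hX0, ← Real.rpow_add hX0]
      ring_nf
    have a4 : 24 * (X ^ θ₁ * X ^ (κ * (1 - θ₁))) ≤ H := by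
      refine le_trans ?_ hl
      rw [a3]
      rw [div_le_iff₀ hc₁] at hbig
      have : 0 ≤ X ^ θ₁ * X ^ (κ * (1 - θ₁)) := by positivity
      nlinarith
    have a5 : (m : ℝ) = (m : ℝ) ^ θ₁ * (m : ℝ) ^ (1 - θ₁) := by
      rw [← Real.rpow_add hm0]
      simp
    have a6 : 2 * (X ^ θ₁ / (m : ℝ) ^ θ₁) ≤ (H : ℝ) / m / 2 := by
      rw [div_div, mul_div_assoc', div_le_div_iff₀ (by positivity) (by positivity)]
      have p := Real.rpow_pos_of_pos hm0 θ₁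
      have q := Real.rpow_pos_of_pos hX0 θ₁
      calc 2 * X ^ θ₁ * (m * 2) = 4 * X ^ θ₁ * ((m : ℝ) ^ θ₁ * (m : ℝ) ^ (1 - θ₁)) := by
            rw [← a5]
            ring
        _ ≤ 4 * X ^ θ₁ * ((m : ℝ) ^ θ₁ * (6 * X ^ (κ * (1 - θ₁)))) := by gcongr
        _ = 24 * (X ^ θ₁ * X ^ (κ * (1 - θ₁))) * (m : ℝ) ^ θ₁ := by ring
        _ ≤ _ := by gcongr
    linarith
  have key2 : (h : ℝ) ≤ max 1 (2 * c₂) * (M : ℝ) ^ ϑ := by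
    have b1 : (X / m) ^ ϑ ≤ 2 * (M : ℝ) ^ ϑ := by
      calc (X / m) ^ ϑ ≤ (2 * M : ℝ) ^ ϑ := Real.rpow_le_rpow (by positivity) hM4 hϑ0.le
        _ = 2 ^ ϑ * (M : ℝ) ^ ϑ := Real.mul_rpow (by norm_num) (by positivity)
        _ ≤ 2 ^ (1 : ℝ) * (M : ℝ) ^ ϑ := by gcongr; norm_num
        _ = _ := by rw [Real.rpow_one]
    have b2 : X ^ ϑ / m ≤ (X / m) ^ ϑ := by
      rw [Real.div_rpow hX0.le hm0.le]
      have : (m : ℝ) ^ ϑ ≤ (m : ℝ) ^ (1 : ℝ) := Real.rpow_le_rpow_of_exponent_le hm1 hϑ1.le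
      rw [Real.rpow_one] at this
      gcongr
    have hc₂ : 0 ≤ c₂ := by
      have : 0 < X ^ ϑ := by positivity
      have : 0 ≤ c₂ * X ^ ϑ := le_trans (by positivity) hu
      by_contra! hneg
      nlinarith
    calc (h : ℝ) ≤ H / m := hh1
      _ ≤ c₂ * X ^ ϑ / m := by gcongr
      _ = c₂ * (X ^ ϑ / m) := by ring
      _ ≤ c₂ * (2 * (M : ℝ) ^ ϑ) := by
          have := b2.trans b1
          gcongr
      _ = (2 * c₂) * (M : ℝ) ^ ϑ := by ring
      _ ≤ _ := by
          gcongr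
          exact le_max_right _ _
  have hM0 : 0 < M := by omega
  refine (hJ M h hM0 h0 key key2).trans ?_
  have e1 : (M : ℝ) ^ η ≤ 2 * X ^ η := by
    calc (M : ℝ) ^ η ≤ (2 * X) ^ η := by
          refine Real.rpow_le_rpow (by positivity) (hM3.trans ?_) hη0.le
          exact div_le_self (by positivity) hm1
      _ = 2 ^ η * X ^ η := Real.mul_rpow (by norm_num) (by positivity)
      _ ≤ 2 ^ (1 : ℝ) * X ^ η := by gcongr; norm_num
      _ = _ := by rw [Real.rpow_one]
  have e2 : (h : ℝ) ^ (2 - G) ≤ (H : ℝ) ^ (2 - G) * ((m : ℝ) ^ G / (m : ℝ) ^ 2) := by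
    calc (h : ℝ) ^ (2 - G) ≤ (H / m : ℝ) ^ (2 - G) := Real.rpow_le_rpow (by positivity) hh1 (by linarith)
      _ = _ := by
          rw [Real.div_rpow (by positivity) hm0.le, Real.rpow_sub hm0, Real.rpow_ofNat]
          field_simp
  have e3 : (m : ℝ) ^ G ≤ 6 * X ^ (κ * G) := by
    calc (m : ℝ) ^ G ≤ (6 * X ^ κ) ^ G := Real.rpow_le_rpow hm0.le hmQ hG0.le
      _ = 6 ^ G * X ^ (κ * G) := by
          rw [Real.mul_rpow (by norm_num) (by positivity), Real.rpow_mul hX0.le]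
      _ ≤ 6 ^ (1 : ℝ) * X ^ (κ * G) := by gcongr; norm_num
      _ = _ := by rw [Real.rpow_one]
  calc C * ((M : ℝ) ^ η * ((M : ℝ) * (h : ℝ) ^ (2 - G)))
      ≤ C * ((2 * X ^ η) * ((2 * X / m) * ((H : ℝ) ^ (2 - G) * ((6 * X ^ (κ * G)) / (m : ℝ) ^ 2)))) := by
        have := e2.trans (mul_le_mul_of_nonneg_left (div_le_div_of_nonneg_right e3 (by positivity))
          (by positivity))
        gcongr
    _ = _ := by
        rw [Real.rpow_add hX0, Real.rpow_add hX0, Real.rpow_one]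
        field_simp
        ring

lemma large_sieve_term_le {X D H K h₁ h₂ A B c κ ϑ η τ : ℝ} (hX : 1 ≤ X) (hD0 : 0 ≤ D)
    (hD : D ≤ X ^ (1 - κ)) (hh₁0 : 0 ≤ h₁) (hh₁ : h₁ ≤ A * X ^ (2 * η)) (hh₂0 : 0 ≤ h₂)
    (hh₂ : h₂ ≤ A * X ^ η) (hK : K ^ 2 ≤ B * X ^ η) (hH0 : 0 ≤ H) (hH : H ≤ c * X ^ ϑ)
    (hA : 0 < A) (hB : 0 < B) (hc : 0 < c) (e₁ : ϑ + 5 * η ≤ τ) (e₂ : 1 - 2 * κ + ϑ + 7 * η ≤ τ) :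
    (X + 2 * D ^ 2 * h₁) * (8 * H * K ^ 2 * h₂ ^ 4) ≤ 8 * c * B * A ^ 4 * (1 + 2 * A) * X ^ (1 + τ) := by
  have hX0 : 0 < X := by linarith
  have p₁ : X ^ (1 + ϑ + 5 * η) ≤ X ^ (1 + τ) := Real.rpow_le_rpow_of_exponent_le hX (by linarith)
  have p₂ : X ^ (2 - 2 * κ + ϑ + 7 * η) ≤ X ^ (1 + τ) := Real.rpow_le_rpow_of_exponent_le hX (by linarith)
  have q₁ : X ^ (1 + ϑ + 5 * η) = X * X ^ ϑ * X ^ η * (X ^ η) ^ 4 := by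
    rw [← Real.rpow_natCast (X ^ η) 4, ← Real.rpow_mul hX0.le]
    nth_rewrite 2 [← Real.rpow_one X]
    simp only [← Real.rpow_add hX0]
    congr 1
    push_cast
    ring
  have q₂ : X ^ (2 - 2 * κ + ϑ + 7 * η) = (X ^ (1 - κ)) ^ 2 * X ^ (2 * η) * X ^ ϑ * X ^ η * (X ^ η) ^ 4 := by
    rw [← Real.rpow_natCast (X ^ η) 4, ← Real.rpow_mul hX0.le, ← Real.rpow_natCast (X ^ (1 - κ)) 2,
      ← Real.rpow_mul hX0.le]
    simp only [← Real.rpow_add hX0]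
    congr 1
    push_cast
    ring
  calc (X + 2 * D ^ 2 * h₁) * (8 * H * K ^ 2 * h₂ ^ 4)
      ≤ (X + 2 * (X ^ (1 - κ)) ^ 2 * (A * X ^ (2 * η)))
        * (8 * (c * X ^ ϑ) * (B * X ^ η) * (A * X ^ η) ^ 4) := by gcongr
    _ = 8 * c * B * A ^ 4 * (X ^ (1 + ϑ + 5 * η) + 2 * A * X ^ (2 - 2 * κ + ϑ + 7 * η)) := by
        rw [q₁, q₂]
        ring
    _ ≤ 8 * c * B * A ^ 4 * (X ^ (1 + τ) + 2 * A * X ^ (1 + τ)) := by gcongr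
    _ = _ := by ring

lemma boundary_term_le {X D H K B c κ ϑ η τ : ℝ} (hX : 1 ≤ X)
    (hD : D ≤ X ^ (1 - κ)) (hD2 : X ^ (1 - κ) ≤ 2 * D) (hK : K ^ 2 ≤ B * X ^ η) (hH0 : 0 ≤ H)
    (hH : H ≤ c * X ^ ϑ) (hB : 0 < B) (hc : 0 < c) (hκ : κ ≤ ϑ)
    (e₁ : 2 * (ϑ - κ) + η ≤ τ) (e₂ : 4 * ϑ - 2 + η ≤ τ) :
    X * (K * (2 * H / D + 1) * (4 * H * D / X + 1)) ^ 2
      ≤ B * (4 * c + 1) ^ 2 * (32 * c ^ 2 + 2) * X ^ (1 + τ) := by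
  have hX0 : 0 < X := by linarith
  have hXκ : 0 < X ^ (1 - κ) := by positivity
  have hD0 : 0 < D := by linarith
  have p₁ : X ^ (1 + (2 * (ϑ - κ) + η)) ≤ X ^ (1 + τ) := Real.rpow_le_rpow_of_exponent_le hX (by linarith)
  have p₂ : X ^ (1 + (4 * ϑ - 2 + η)) ≤ X ^ (1 + τ) := Real.rpow_le_rpow_of_exponent_le hX (by linarith)
  have q₁ : X ^ (1 + (2 * (ϑ - κ) + η)) = X * X ^ η * (X ^ (ϑ - κ)) ^ 2 := by
    rw [← Real.rpow_natCast (X ^ (ϑ - κ)) 2, ← Real.rpow_mul hX0.le]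
    nth_rewrite 2 [← Real.rpow_one X]
    simp only [← Real.rpow_add hX0]
    congr 1
    push_cast
    ring
  have q₂ : X ^ (1 + (4 * ϑ - 2 + η)) = X * X ^ η * (X ^ (ϑ - κ)) ^ 2 * (X ^ (ϑ + κ - 1)) ^ 2 := by
    rw [← Real.rpow_natCast (X ^ (ϑ - κ)) 2, ← Real.rpow_mul hX0.le,
      ← Real.rpow_natCast (X ^ (ϑ + κ - 1)) 2, ← Real.rpow_mul hX0.le]
    nth_rewrite 2 [← Real.rpow_one X]
    simp only [← Real.rpow_add hX0]
    congr 1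
    push_cast
    ring
  have a₁ : 2 * H / D ≤ 4 * c * X ^ (ϑ + κ - 1) := by
    rw [div_le_iff₀ hD0]
    have : X ^ ϑ = X ^ (ϑ + κ - 1) * X ^ (1 - κ) := by
      rw [← Real.rpow_add hX0]
      ring_nf
    calc 2 * H ≤ 2 * (c * X ^ ϑ) := by gcongr
      _ = 2 * c * X ^ (ϑ + κ - 1) * X ^ (1 - κ) := by
          rw [this]
          ring
      _ ≤ 2 * c * X ^ (ϑ + κ - 1) * (2 * D) := by gcongr
      _ = _ := by ring
  have a₂ : 4 * H * D / X ≤ 4 * c * X ^ (ϑ - κ) := by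
    rw [div_le_iff₀ hX0]
    have : X ^ ϑ * X ^ (1 - κ) = X ^ (ϑ - κ) * X := by
      nth_rewrite 4 [← Real.rpow_one X]
      rw [← Real.rpow_add hX0, ← Real.rpow_add hX0]
      ring_nf
    calc 4 * H * D ≤ 4 * (c * X ^ ϑ) * X ^ (1 - κ) := by gcongr
      _ = 4 * c * (X ^ ϑ * X ^ (1 - κ)) := by ring
      _ = _ := by
          rw [this]
          ring
  have a₃ : 1 ≤ X ^ (ϑ - κ) := Real.one_le_rpow hX (by linarith)
  have a₄ : 4 * H * D / X + 1 ≤ (4 * c + 1) * X ^ (ϑ - κ) := by linarith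
  have a₅ : (4 * c * X ^ (ϑ + κ - 1) + 1) ^ 2 ≤ 32 * c ^ 2 * (X ^ (ϑ + κ - 1)) ^ 2 + 2 := by
    nlinarith [sq_nonneg (4 * c * X ^ (ϑ + κ - 1) - 1)]
  calc X * (K * (2 * H / D + 1) * (4 * H * D / X + 1)) ^ 2
      = X * (K ^ 2 * (2 * H / D + 1) ^ 2 * (4 * H * D / X + 1) ^ 2) := by ring
    _ ≤ X * ((B * X ^ η) * (4 * c * X ^ (ϑ + κ - 1) + 1) ^ 2 * ((4 * c + 1) * X ^ (ϑ - κ)) ^ 2) := by gcongr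
    _ ≤ X * ((B * X ^ η) * (32 * c ^ 2 * (X ^ (ϑ + κ - 1)) ^ 2 + 2) * ((4 * c + 1) * X ^ (ϑ - κ)) ^ 2) := by
        gcongr
    _ = B * (4 * c + 1) ^ 2 * (32 * c ^ 2 * X ^ (1 + (4 * ϑ - 2 + η)) + 2 * X ^ (1 + (2 * (ϑ - κ) + η))) := by
        rw [q₁, q₂]
        ring
    _ ≤ B * (4 * c + 1) ^ 2 * (32 * c ^ 2 * X ^ (1 + τ) + 2 * X ^ (1 + τ)) := by gcongr
    _ = _ := by ring

open Finset in
lemma dilated_term_le {X H K A B C c κ ϑ G η τ : ℝ} {Q : ℕ} {J : ℕ → ℝ} (hX : 1 ≤ X) (hA : 0 < A)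
    (hB : 0 < B) (hC : 0 < C) (hc : 0 < c) (hG : G ≤ 2) (hQ : (Q : ℝ) ≤ 6 * X ^ κ)
    (hharm : harm Q ≤ A * X ^ η) (hK : K ^ 2 ≤ B * X ^ η) (hH0 : 0 ≤ H) (hH : H ≤ c * X ^ ϑ)
    (hJ : ∀ m ∈ Icc 1 Q, J m ≤ 2 * (24 * C * (X ^ (1 + κ * G + η) * H ^ (2 - G)) / (m : ℝ) ^ 3))
    (e₁ : ϑ * (2 - G) + κ * G + 3 * η ≤ τ) (e₂ : 2 * κ + 2 * η ≤ τ) :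
    harm Q * ∑ m ∈ Icc 1 Q, m * (2 * m * J m + 72 * K ^ 2 * X)
      ≤ A * (96 * C * A * c ^ (2 - G) + 72 * B * 36) * X ^ (1 + τ) := by
  have hX0 : 0 < X := by linarith
  have p₁ : X ^ (1 + (ϑ * (2 - G) + κ * G + 3 * η)) ≤ X ^ (1 + τ) :=
    Real.rpow_le_rpow_of_exponent_le hX (by linarith)
  have p₂ : X ^ (1 + (2 * κ + 2 * η)) ≤ X ^ (1 + τ) := Real.rpow_le_rpow_of_exponent_le hX (by linarith)
  have q₁ : X ^ (1 + (ϑ * (2 - G) + κ * G + 3 * η))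
      = X ^ η * (X ^ (1 + κ * G + η) * X ^ (ϑ * (2 - G))) * X ^ η := by
    simp only [← Real.rpow_add hX0]
    congr 1
    ring
  have q₂ : X ^ (1 + (2 * κ + 2 * η)) = X ^ η * X ^ η * X * (X ^ κ) ^ 2 := by
    rw [← Real.rpow_natCast (X ^ κ) 2, ← Real.rpow_mul hX0.le]
    nth_rewrite 4 [← Real.rpow_one X]
    simp only [← Real.rpow_add hX0]
    congr 1
    push_cast
    ring
  set P := X ^ (1 + κ * G + η) * H ^ (2 - G) with hP
  have hP2 : P ≤ c ^ (2 - G) * (X ^ (1 + κ * G + η) * X ^ (ϑ * (2 - G))) := by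
    have : H ^ (2 - G) ≤ c ^ (2 - G) * X ^ (ϑ * (2 - G)) := by
      refine (Real.rpow_le_rpow hH0 hH (by linarith)).trans (le_of_eq ?_)
      rw [Real.mul_rpow hc.le (by positivity), Real.rpow_mul hX0.le]
    calc P ≤ X ^ (1 + κ * G + η) * (c ^ (2 - G) * X ^ (ϑ * (2 - G))) := by
          rw [hP]
          gcongr
      _ = _ := by ring
  have hP0 : 0 ≤ P := by positivity
  have hh0 := harm_nonneg Q
  have hsum : ∑ m ∈ Icc 1 Q, (m : ℝ) * (2 * m * J m + 72 * K ^ 2 * X)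
      ≤ 96 * C * P * harm Q + 72 * K ^ 2 * X * (Q : ℝ) ^ 2 := by
    have : (Q : ℝ) ^ 2 = ∑ _m ∈ Icc 1 Q, (Q : ℝ) := by
      rw [sum_const, Nat.card_Icc, nsmul_eq_mul, Nat.add_sub_cancel, sq]
    rw [this, harm, mul_sum, mul_sum, ← sum_add_distrib]
    refine sum_le_sum fun m hm => ?_
    have hm1 : (1 : ℝ) ≤ m := by exact_mod_cast (mem_Icc.1 hm).1
    have hmQ : (m : ℝ) ≤ Q := by exact_mod_cast (mem_Icc.1 hm).2
    have hm0 : (0 : ℝ) < m := by linarith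
    have h1 : (m : ℝ) * (2 * m * J m) ≤ 96 * C * P * (1 / m) := by
      calc (m : ℝ) * (2 * m * J m) ≤ m * (2 * m * (2 * (24 * C * P / (m : ℝ) ^ 3))) := by
            have := hJ m hm
            gcongr
        _ = _ := by
            field_simp
            ring
    have h2 : 72 * K ^ 2 * X * (m : ℝ) ≤ 72 * K ^ 2 * X * Q := by gcongr
    linarith
  calc harm Q * ∑ m ∈ Icc 1 Q, (m : ℝ) * (2 * m * J m + 72 * K ^ 2 * X)
      ≤ harm Q * (96 * C * P * harm Q + 72 * K ^ 2 * X * (Q : ℝ) ^ 2) := by gcongr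
    _ ≤ (A * X ^ η) * (96 * C * (c ^ (2 - G) * (X ^ (1 + κ * G + η) * X ^ (ϑ * (2 - G)))) * (A * X ^ η)
        + 72 * (B * X ^ η) * X * (6 * X ^ κ) ^ 2) := by gcongr
    _ = A * (96 * C * A * c ^ (2 - G) * X ^ (1 + (ϑ * (2 - G) + κ * G + 3 * η))
        + 72 * B * 36 * X ^ (1 + (2 * κ + 2 * η))) := by
        rw [q₁, q₂]
        ring
    _ ≤ A * (96 * C * A * c ^ (2 - G) * X ^ (1 + τ) + 72 * B * 36 * X ^ (1 + τ)) := by gcongr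
    _ = _ := by ring

theorem stmt0 (g : ℕ → ℝ) (hg : EssBdd g) (ϑ G : ℝ)
    (hϑ1 : 1 / 3 < ϑ) (hϑ2 : ϑ < 1) (hG1 : 0 < G) (hG2 : G < 1)
    (hyp : ∀ θ : ℝ, (3 * ϑ - 1) / ((1 - G) * ϑ + G + 1) < θ → θ ≤ ϑ →
      ∀ c₁ c₂ : ℝ, 0 < c₁ → c₁ < c₂ →
        ∃ C : ℝ, 0 < C ∧ ∀ M h : ℕ, 0 < M → 0 < h →
          c₁ * (M : ℝ) ^ θ ≤ (h : ℝ) → (h : ℝ) ≤ c₂ * (M : ℝ) ^ θ →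
          Jsgn g M h ≤ C * (M : ℝ) * (h : ℝ) ^ (2 - G)) :
    ∀ G' : ℝ, 0 < G' → G' < min ((3 - ϑ⁻¹) / (1 + 2 * G⁻¹)) (ϑ⁻¹ - 1) →
      ∀ c₁ c₂ : ℝ, 0 < c₁ → c₁ < c₂ →
        ∃ C' : ℝ, 0 < C' ∧ ∀ N H : ℕ, 0 < N → 0 < H →
          c₁ * (N : ℝ) ^ ϑ ≤ (H : ℝ) → (H : ℝ) ≤ c₂ * (N : ℝ) ^ ϑ →
          Jsgn (fun n => ∑ d ∈ n.divisors, g d) N H ≤ C' * (N : ℝ) * (H : ℝ) ^ (2 - G') := by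
  intro G' hG'0 hG' c₁ c₂ hc₁ hc₁₂
  have hc₂ : 0 < c₂ := hc₁.trans hc₁₂
  have hϑ0 : 0 < ϑ := by linarith
  obtain ⟨hA, hB⟩ := lt_min_iff.1 hG'
  have hA' : ϑ * G' * (G + 2) < G * (3 * ϑ - 1) := by
    rw [lt_div_iff₀ (by positivity)] at hA
    have := mul_lt_mul_of_pos_left hA (mul_pos hϑ0 hG1)
    have e1 : ϑ * G * (G' * (1 + 2 * G⁻¹)) = ϑ * G' * (G + 2) := by field_simp
    have e2 : ϑ * G * (3 - ϑ⁻¹) = G * (3 * ϑ - 1) := by field_simp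
    rwa [e1, e2] at this
  have hB' : ϑ * (1 + G') < 1 := by
    have := mul_lt_mul_of_pos_left hB hϑ0
    have e : ϑ * (ϑ⁻¹ - 1) = 1 - ϑ := by field_simp
    rw [e] at this
    linarith
  obtain ⟨κ, θ₁, η, hκ0, hκϑ, hθ0, hθϑ, hθ1, hθκ, hη0, hη1, f1, f2, f3, f4, f5, f6⟩ :=
    exists_parameters hϑ1 hϑ2 hG1 hG2 hG'0 hA' hB'
  have hG'2 : G' ≤ 2 := by
    have : 0 ≤ ϑ * (2 - G') := by linarith
    by_contra! h
    nlinarith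
  set τ := ϑ * (2 - G') with hτ
  obtain ⟨C, hC, hJ⟩ := Jsgn_le_uniform hg hθ0 hθϑ hϑ2 (by linarith : G ≤ 2) hη0
    (le_max_left 1 (2 * c₂)) fun θ h1 h2 => hyp θ (hθ1.trans_le h1) h2
  obtain ⟨A, hA0, hharm⟩ := exists_harm_le_rpow hη0
  obtain ⟨B, hB0, hK⟩ := hg.exists_sq_bound hη0 3
  obtain ⟨N₁, hN₁⟩ := exists_forall_le_rpow (e := 1 - ϑ) (by linarith) (4 * c₂)
  obtain ⟨N₂, hN₂⟩ := exists_forall_le_rpow (e := 1 - κ) (by linarith) 9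
  obtain ⟨N₃, hN₃⟩ := exists_forall_le_rpow (e := ϑ - κ) (by linarith) (6 / c₁)
  obtain ⟨N₄, hN₄⟩ := exists_forall_le_rpow (e := ϑ - κ - θ₁ * (1 - κ)) (by linarith) (24 / c₁)
  set C₀ := 3 * (8 * c₂ * B * A ^ 4 * (1 + 2 * A)) + 3 * (A * (96 * C * A * c₂ ^ (2 - G) + 72 * B * 36))
    + 3 * (B * (4 * c₂ + 1) ^ 2 * (32 * c₂ ^ 2 + 2)) with hC₀
  have large : ∃ C' : ℝ, 0 < C' ∧ ∀ N H : ℕ, N₁ + N₂ + N₃ + N₄ ≤ N → 0 < N → 0 < H →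
      (c₁ * (N : ℝ) ^ ϑ ≤ (H : ℝ) ∧ (H : ℝ) ≤ c₂ * (N : ℝ) ^ ϑ) →
      Jsgn (fun n => ∑ d ∈ n.divisors, g d) N H ≤ C' * ((N : ℝ) * (H : ℝ) ^ (2 - G')) := by
    refine ⟨C₀ / c₁ ^ (2 - G'), by positivity, ?_⟩
    rintro N H hNN hN hH ⟨hl, hu⟩
    have b1 := hN₁ N (by omega)
    have b2 := hN₂ N (by omega)
    have b3 := hN₃ N (by omega)
    have b4 := hN₄ N (by omega)
    have hX1 : (1 : ℝ) ≤ N := Nat.one_le_cast.2 hN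
    have hX0 : (0 : ℝ) < N := by linarith
    obtain ⟨K, hK0, hKb, hK2⟩ := hK N hN
    have hH4 : 4 * H ≤ N := by
      have e : (N : ℝ) ^ (1 - ϑ) * (N : ℝ) ^ ϑ = N := by
        rw [← Real.rpow_add hX0]
        simp
      have : (4 * H : ℝ) ≤ N := by
        calc (4 * H : ℝ) ≤ 4 * c₂ * (N : ℝ) ^ ϑ := by linarith
          _ ≤ (N : ℝ) ^ (1 - ϑ) * (N : ℝ) ^ ϑ := by gcongr
          _ = N := e
      exact_mod_cast this
    set D := ⌊(N : ℝ) ^ (1 - κ)⌋₊ with hD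
    have hD9 : 9 ≤ D := Nat.le_floor (by exact_mod_cast b2)
    have hDle : (D : ℝ) ≤ (N : ℝ) ^ (1 - κ) := Nat.floor_le (by positivity)
    have hDge : (N : ℝ) ^ (1 - κ) ≤ 2 * D := by
      have h1 : (N : ℝ) ^ (1 - κ) < D + 1 := Nat.lt_floor_add_one _
      have h2 : (9 : ℝ) ≤ D := by exact_mod_cast hD9
      linarith
    have hDNr : (D : ℝ) ≤ N :=
      hDle.trans ((Real.rpow_le_rpow_of_exponent_le hX1 (by linarith)).trans_eq (Real.rpow_one _))
    have hDN : D ≤ N := by exact_mod_cast hDNr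
    have hQ3 : 3 * (3 * N / D) ≤ N := by
      have : 3 * N / D ≤ 3 * N / 9 := Nat.div_le_div_left hD9 (by norm_num)
      omega
    have hQ : ((3 * N / D : ℕ) : ℝ) ≤ 6 * (N : ℝ) ^ κ := by
      have h1 : ((3 * N / D : ℕ) : ℝ) ≤ 3 * N / D := by
        have := @Nat.cast_div_le ℝ _ _ _ (3 * N) D
        push_cast at this
        exact this
      refine h1.trans ?_
      have : (N : ℝ) = (N : ℝ) ^ κ * (N : ℝ) ^ (1 - κ) := by
        rw [← Real.rpow_add hX0]
        simp
      rw [div_le_iff₀ (by positivity)]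
      have p : 0 ≤ (N : ℝ) ^ κ := by positivity
      calc (3 * N : ℝ) = 3 * ((N : ℝ) ^ κ * (N : ℝ) ^ (1 - κ)) := by rw [← this]
        _ ≤ 3 * ((N : ℝ) ^ κ * (2 * D)) := by gcongr
        _ = _ := by ring
    have fin := Jsgn_sum_divisors_le g hK0 hKb hN (by omega : 0 < D) hDN hH4 hQ3
    generalize hQd : 3 * N / D = Q at fin hQ hQ3
    have hharmle : ∀ n : ℕ, n ≤ N → harm n ≤ A * (N : ℝ) ^ η := fun n hn =>
      (harm_mono hn).trans (hharm N hN)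
    have hharmD : harm (D ^ 2) ≤ A * (N : ℝ) ^ (2 * η) := by
      refine (harm_mono (Nat.pow_le_pow_left hDN 2)).trans ((hharm (N ^ 2) (by positivity)).trans_eq ?_)
      rw [Nat.cast_pow, ← Real.rpow_natCast, ← Real.rpow_mul hX0.le, Nat.cast_ofNat]
    have t1 := large_sieve_term_le hX1 (Nat.cast_nonneg D) hDle (harm_nonneg _) hharmD (harm_nonneg _)
      (hharmle D hDN) hK2 (Nat.cast_nonneg H) hu hA0 hB0 hc₂ f1 f2
    have t3 := boundary_term_le hX1 hDle hDge hK2 (Nat.cast_nonneg H) hu hB0 hc₂ hκϑ.le f5 f6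
    have hQH : Q ≤ H := by
      have e : (N : ℝ) ^ ϑ = (N : ℝ) ^ (ϑ - κ) * (N : ℝ) ^ κ := by
        rw [← Real.rpow_add hX0]
        simp
      rw [div_le_iff₀ hc₁] at b3
      have : (Q : ℝ) ≤ H := by
        calc (Q : ℝ) ≤ 6 * (N : ℝ) ^ κ := hQ
          _ ≤ ((N : ℝ) ^ (ϑ - κ) * c₁) * (N : ℝ) ^ κ := by gcongr
          _ = c₁ * (N : ℝ) ^ ϑ := by
              rw [e]
              ring
          _ ≤ H := hl
      exact_mod_cast this
    have t2 := dilated_term_le (J := fun m => Jsgn g (N / m - 1) (H / m) + Jsgn g (2 * (N / m - 1)) (H / m))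
      hX1 hA0 hB0 hC hc₂ (by linarith : G ≤ 2) hQ (hharmle Q (by omega)) hK2 (Nat.cast_nonneg H) hu ?_ f3 f4
    · have hW : (N : ℝ) ^ (1 + τ) ≤ (N : ℝ) * (H : ℝ) ^ (2 - G') / c₁ ^ (2 - G') := by
        rw [le_div_iff₀ (by positivity), Real.rpow_add hX0, Real.rpow_one, mul_assoc]
        refine mul_le_mul_of_nonneg_left ?_ hX0.le
        calc (N : ℝ) ^ τ * c₁ ^ (2 - G') = (c₁ * (N : ℝ) ^ ϑ) ^ (2 - G') := by
              rw [Real.mul_rpow hc₁.le (by positivity), ← Real.rpow_mul hX0.le, mul_comm]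
          _ ≤ _ := Real.rpow_le_rpow (by positivity) hl (by linarith)
      calc Jsgn (fun n => ∑ d ∈ n.divisors, g d) N H ≤ C₀ * (N : ℝ) ^ (1 + τ) := by
            rw [hC₀]
            linarith
        _ ≤ C₀ * ((N : ℝ) * (H : ℝ) ^ (2 - G') / c₁ ^ (2 - G')) := by gcongr
        _ = _ := by ring
    · intro m hm
      rw [Finset.mem_Icc] at hm
      have hNm : 3 ≤ N / m := by
        rw [Nat.le_div_iff_mul_le hm.1]
        omega
      have hmQ : (m : ℝ) ≤ 6 * (N : ℝ) ^ κ := le_trans (by exact_mod_cast hm.2) hQ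
      have j : ∀ M : ℕ, N / m - 1 ≤ M → M ≤ 2 * (N / m - 1) → _ := fun M h1 h2 =>
        Jsgn_div_le hθ0 (hθϑ.trans hϑ2) hϑ0 hϑ2 hG1 hG2 hη0 hη1 hc₁ hC hJ hm.1 hmQ hNm (hm.2.trans hQH)
          hl hu b4 h1 h2
      have j1 := j (N / m - 1) le_rfl (by omega)
      have j2 := j (2 * (N / m - 1)) (by omega) le_rfl
      linarith
  obtain ⟨C', hC', main⟩ := exists_const_of_large (fun N H => Jsgn (fun n => ∑ d ∈ n.divisors, g d) N H)
    (fun N H => (N : ℝ) * (H : ℝ) ^ (2 - G'))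
    (fun N H => c₁ * (N : ℝ) ^ ϑ ≤ (H : ℝ) ∧ (H : ℝ) ≤ c₂ * (N : ℝ) ^ ϑ) c₂ (N₁ + N₂ + N₃ + N₄)
    (fun N H hN hH => one_le_mul_of_one_le_of_one_le (Nat.one_le_cast.2 hN)
      (Real.one_le_rpow (Nat.one_le_cast.2 hH) (by linarith)))
    (fun N H hN hNH => hNH.2.trans (mul_le_mul_of_nonneg_left
      ((Real.rpow_le_rpow_of_exponent_le (Nat.one_le_cast.2 hN) hϑ2.le).trans_eq (Real.rpow_one _)) hc₂.le))
    large
  refine ⟨C', hC', fun N H hN hH h1 h2 => ?_⟩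
  rw [mul_assoc]
  exact main N H hN hH ⟨h1, h2⟩
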